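/- arXiv:2601.08150 — 3 statements merged into one kernel-verified Lean document; each statement's English description precedes it below -/
import Mathlib

section
/- Let H be a finite directed multigraph with a cyclic ample framing. Then every monochromatic route of H (a route all of whose edges have the same colour) is either a minimal directed cycle or a good route; in particular no bad route is monochromatic. Moreover, every edge of H lies in exactly one monochromatic route. -/
namespace PaperDKK

/-- Edge colours for framings. -/
inductive Col : Type
  | red : Col
  | blue : Col
  deriving DecidableEq

variable {V E : Type*}

/-- The list of vertices visited by a walk. -/
def walkVerts (tl hd : E → V) : List E → List V
  | [] => []
  | e :: es => tl e :: (e :: es).map hd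

/-- A walk: a nonempty list of consecutively composable edges. -/
def IsWalk (tl hd : E → V) (w : List E) : Prop :=
  w ≠ [] ∧ List.Chain' (fun e f => hd e = tl f) w

/-- A source: a vertex that is the head of no edge. -/
def IsSource (tl hd : E → V) (v : V) : Prop := ∀ e : E, hd e ≠ v

/-- A sink: a vertex that is the tail of no edge. -/
def IsSink (tl hd : E → V) (v : V) : Prop := ∀ e : E, tl e ≠ v

/-- An internal vertex: neither a source nor a sink. -/
def IsInternal (tl hd : E → V) (v : V) : Prop :=
  ¬ IsSource tl hd v ∧ ¬ IsSink tl hd v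

/-- A minimal directed cycle: a closed walk visiting no vertex twice. -/
def IsMinCycle (tl hd : E → V) (w : List E) : Prop :=
  IsWalk tl hd w ∧
  (∀ e ∈ w.getLast?, ∀ f ∈ w.head?, hd e = tl f) ∧
  (w.map hd).Nodup

/-- A walk from a source to a sink. -/
def IsSrcSnkWalk (tl hd : E → V) (w : List E) : Prop :=
  IsWalk tl hd w ∧
  (∀ e ∈ w.head?, IsSource tl hd (tl e)) ∧
  (∀ e ∈ w.getLast?, IsSink tl hd (hd e))

/-- A route: a minimal directed cycle or a source-to-sink walk. -/
def IsRoute (tl hd : E → V) (w : List E) : Prop :=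
  IsMinCycle tl hd w ∨ IsSrcSnkWalk tl hd w

/-- A good route: a source-to-sink walk none of whose contiguous subwalks is a
minimal directed cycle. -/
def IsGoodRoute (tl hd : E → V) (w : List E) : Prop :=
  IsSrcSnkWalk tl hd w ∧ ∀ u : List E, u <:+: w → ¬ IsMinCycle tl hd u

/-- A monochromatic list of edges. -/
def Mono (col : E → Col) (w : List E) : Prop :=
  ∃ b : Col, ∀ e ∈ w, col e = b

/-- Cyclic ample framing: at every internal vertex there is exactly one red and
one blue incoming edge and exactly one red and one blue outgoing edge, and every
minimal directed cycle is monochromatic. -/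
def CyclicAmpleFraming (tl hd : E → V) (col : E → Col) : Prop :=
  (∀ v : V, IsInternal tl hd v →
    (∃! e : E, hd e = v ∧ col e = Col.red) ∧
    (∃! e : E, hd e = v ∧ col e = Col.blue) ∧
    (∃! e : E, tl e = v ∧ col e = Col.red) ∧
    (∃! e : E, tl e = v ∧ col e = Col.blue)) ∧
  (∀ w : List E, IsMinCycle tl hd w → Mono col w)

/-- Incompatibility of two source-to-sink walks: they admit decompositions
`P·S·Q` and `P′·S·Q′` along a common (possibly vertex-only) subwalk `S`, with
the last edge of `P` and the first edge of `Q′` blue while the first edge of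
`Q` and the last edge of `P′` are red.  Here the `P`-part is `P ++ [p]` and the
`Q`-part is `q :: Q`, so `p` is the last edge of the `P`-part and `q` the first
edge of the `Q`-part. -/
def Incompat (tl hd : E → V) (col : E → Col) (w w' : List E) : Prop :=
  IsSrcSnkWalk tl hd w ∧ IsSrcSnkWalk tl hd w' ∧
  ∃ (P S Q P' Q' : List E) (p q p' q' : E),
    ((w = P ++ p :: (S ++ q :: Q) ∧ w' = P' ++ p' :: (S ++ q' :: Q')) ∨
     (w' = P ++ p :: (S ++ q :: Q) ∧ w = P' ++ p' :: (S ++ q' :: Q'))) ∧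
    hd p = hd p' ∧
    col p = Col.blue ∧ col q' = Col.blue ∧ col q = Col.red ∧ col p' = Col.red

/-- A route is exceptional if it is compatible with every route. -/
def Exceptional (tl hd : E → V) (col : E → Col) (w : List E) : Prop :=
  IsRoute tl hd w ∧ ∀ w' : List E, IsRoute tl hd w' → ¬ Incompat tl hd col w w'

/-- Connectivity of the underlying undirected graph. -/
def Connected (tl hd : E → V) : Prop :=
  ∀ v w : V,
    Relation.ReflTransGen
      (fun x y => ∃ e : E, (tl e = x ∧ hd e = y) ∨ (tl e = y ∧ hd e = x)) v w

/-- Every source and every sink has degree one. -/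
def DegreeOneEnds (tl hd : E → V) : Prop :=
  (∀ v : V, IsSource tl hd v → ∃! e : E, tl e = v) ∧
  (∀ v : V, IsSink tl hd v → ∃! e : E, hd e = v)

/-- No idle edges: no edge between internal vertices is the unique outgoing edge
of its tail or the unique incoming edge of its head. -/
def NoIdleEdges (tl hd : E → V) : Prop :=
  ∀ e : E, IsInternal tl hd (tl e) → IsInternal tl hd (hd e) →
    (∃ f : E, f ≠ e ∧ tl f = tl e) ∧ (∃ f : E, f ≠ e ∧ hd f = hd e)

section Orbits

variable {α : Type*} {R : α → α → Prop}

/-- A nonempty duplicate-free `R`-chain that either closes up or can be extended at neither end. -/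
def IsOrbit (R : α → α → Prop) (w : List α) : Prop :=
  w ≠ [] ∧ w.IsChain R ∧ w.Nodup ∧
    ((∀ x ∈ w.getLast?, ∀ y ∈ w.head?, R x y) ∨
      ((∀ y ∈ w.head?, ∀ x, ¬ R x y) ∧ ∀ x ∈ w.getLast?, ∀ y, ¬ R x y))

/-- A chain of a bi-unique relation starting at an element without predecessor has no
repetitions. -/
theorem nodup_of_isChain_of_no_pred (hR : Relator.BiUnique R) {w : List α} (hw : w.IsChain R)
    (h0 : ∀ y ∈ w.head?, ∀ x, ¬ R x y) : w.Nodup := by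
  rw [List.isChain_iff_getElem] at hw
  have key : ∀ i j (hij : i < j) (hj : j < w.length), w[i] ≠ w[j] := by
    intro i
    induction i with
    | zero =>
      intro j hij hj h
      obtain ⟨k, rfl⟩ : ∃ k, j = k + 1 := ⟨j - 1, by omega⟩
      refine h0 w[0] ?_ w[k] (h ▸ hw k hj)
      simp [List.head?_eq_getElem?]
    | succ i ih =>
      intro j hij hj h
      obtain ⟨k, rfl⟩ : ∃ k, j = k + 1 := ⟨j - 1, by omega⟩
      exact ih k (by omega) (by omega) (hR.1 (hw i (by omega)) (h ▸ hw k hj))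
  rw [List.nodup_iff_pairwise_ne, List.pairwise_iff_getElem]
  intro i j hi hj hij
  exact key i j hij hj

theorem IsOrbit.mem_succ (hR : Relator.BiUnique R) {w : List α} (hw : IsOrbit R w) {x y : α}
    (hx : x ∈ w) (hxy : R x y) : y ∈ w := by
  obtain ⟨hne, hc, -, hends⟩ := hw
  obtain ⟨s, t, rfl⟩ := List.append_of_mem hx
  rcases t with _ | ⟨z, t⟩
  · rcases hends with h | h
    · obtain ⟨a, l, hal⟩ := List.exists_cons_of_ne_nil hne
      have := hR.2 hxy (h x (by simp) a (by simp [hal]))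
      simp [hal, this]
    · exact absurd hxy (h.2 x (by simp) y)
  · have : R x z := by
      rw [List.isChain_append] at hc
      exact (List.isChain_cons_cons.1 hc.2.1).1
    simp [hR.2 hxy this]

theorem IsOrbit.reverse {w : List α} (hw : IsOrbit R w) :
    IsOrbit (fun x y => R y x) w.reverse := by
  obtain ⟨hne, hc, hn, hends⟩ := hw
  refine ⟨by simpa, by simpa [List.isChain_reverse, flip] using hc, by simpa, ?_⟩
  rcases hends with h | h
  · exact Or.inl fun x hx y hy => h y (by simpa using hy) x (by simpa using hx)
  · exact Or.inr ⟨fun y hy x => h.2 y (by simpa using hy) x,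
      fun x hx y => h.1 x (by simpa using hx) y⟩

theorem IsOrbit.mem_pred (hR : Relator.BiUnique R) {w : List α} (hw : IsOrbit R w) {x y : α}
    (hy : y ∈ w) (hxy : R x y) : x ∈ w := by
  have hR' : Relator.BiUnique fun x y => R y x :=
    ⟨fun _ _ _ h h' => hR.2 h h', fun _ _ _ h h' => hR.1 h h'⟩
  simpa using hw.reverse.mem_succ hR' (x := y) (y := x) (by simpa) hxy

/-- A property invariant along `R` is constant on an `R`-chain. -/
theorem forall_mem_of_isChain {P : α → Prop} (hP : ∀ x y, R x y → (P x ↔ P y)) {w : List α}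
    (hw : w.IsChain R) {x y : α} (hx : x ∈ w) (hy : y ∈ w) (h : P x) : P y := by
  have key : ∀ (a : α) (l : List α), (a :: l).IsChain R → ∀ z ∈ a :: l, P a ↔ P z := by
    intro a l
    induction l generalizing a with
    | nil => simp
    | cons b l ih =>
      intro hc z hz
      rw [List.isChain_cons_cons] at hc
      rcases List.mem_cons.1 hz with rfl | hz
      · rfl
      · exact (hP a b hc.1).trans (ih b hc.2 z hz)
  rcases w with _ | ⟨a, l⟩
  · simp at hx
  · exact (key a l hw y hy).1 ((key a l hw x hx).2 h)

theorem IsOrbit.subset (hR : Relator.BiUnique R) {w w' : List α} (hw : IsOrbit R w)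
    (hw' : IsOrbit R w') {e : α} (he : e ∈ w) (he' : e ∈ w') : w ⊆ w' := fun _ hy =>
  forall_mem_of_isChain (P := (· ∈ w'))
    (fun _ _ h => ⟨fun hx => hw'.mem_succ hR hx h, fun hy => hw'.mem_pred hR hy h⟩) hw.2.1 he hy he'

/-- Chains of a right-unique relation with the same start and length agree. -/
theorem eq_of_isChain_of_length_eq (hR : Relator.RightUnique R) {a : α} {l l' : List α}
    (h : (a :: l).IsChain R) (h' : (a :: l').IsChain R) (hlen : l.length = l'.length) :
    l = l' := by
  induction l generalizing a l' with
  | nil => exact (List.eq_nil_of_length_eq_zero hlen.symm).symm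
  | cons b l ih =>
    rcases l' with _ | ⟨c, l'⟩
    · simp at hlen
    · rw [List.isChain_cons_cons] at h h'
      obtain rfl := hR h.1 h'.1
      rw [ih h.2 h'.2 (by simpa using hlen)]

theorem IsOrbit.isRotated (hR : Relator.BiUnique R) {w w' : List α} (hw : IsOrbit R w)
    (hw' : IsOrbit R w') {e : α} (he : e ∈ w) (he' : e ∈ w') : w'.IsRotated w := by
  have hperm : w.Perm w' := (List.perm_ext_iff_of_nodup hw.2.2.1 hw'.2.2.1).2 fun x =>
    ⟨fun h => hw.subset hR hw' he he' h, fun h => hw'.subset hR hw he' he h⟩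
  obtain ⟨a, l', rfl⟩ := List.exists_cons_of_ne_nil hw'.1
  have ha : a ∈ w := hperm.mem_iff.2 (by simp)
  obtain ⟨s, t, rfl⟩ := List.append_of_mem ha
  suffices h : (a :: (t ++ s)).IsChain R by
    have hlen : l'.length = (t ++ s).length := by
      have := hperm.length_eq
      simp at this ⊢
      omega
    rw [eq_of_isChain_of_length_eq hR.2 hw'.2.1 h hlen]
    simpa using List.isRotated_append (l := a :: t) (l' := s)
  have hc := List.isChain_append.1 hw.2.1
  rcases List.eq_nil_or_concat s with rfl | ⟨s', p, hs⟩
  · simpa using hc.2.1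
  · have hpa : R p a := hc.2.2 p (by simp [hs]) a (by simp)
    have hclosed' : ∀ x ∈ (a :: l').getLast?, R x a := by
      rcases hw'.2.2.2 with h | h
      · exact fun x hx => h x hx a (by simp)
      · exact absurd hpa (h.1 a (by simp) p)
    have hclosed : ∀ x ∈ (s ++ a :: t).getLast?, ∀ y ∈ (s ++ a :: t).head?, R x y := by
      rcases hw.2.2.2 with h | h
      · exact h
      · exfalso
        obtain ⟨z, hz⟩ : ∃ z, z ∈ (s ++ a :: t).getLast? := by
          simpa [Option.mem_def] using
            Option.isSome_iff_exists.1 (List.getLast?_isSome.2 hw.1)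
        have hz' : z ∈ a :: l' := hperm.mem_iff.1 (List.mem_of_getLast? hz)
        obtain ⟨u, v, huv⟩ := List.append_of_mem hz'
        rcases v with _ | ⟨b, v⟩
        · exact h.2 z hz a (hclosed' z (by simp [huv]))
        · have hc' := hw'.2.1
          rw [huv, List.isChain_append] at hc'
          exact h.2 z hz b (List.isChain_cons_cons.1 hc'.2.1).1
    have := List.isChain_append.2 ⟨hc.2.1, hc.1, fun x hx y hy => hclosed x ?_ y ?_⟩
    · simpa using this
    · rw [List.getLast?_append_of_ne_nil _ (by simp)]
      exact hx
    · rw [List.head?_append_of_ne_nil _ (by simp [hs])]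
      exact hy

theorem exists_isOrbit [Finite α] (hR : Relator.BiUnique R) (e : α) :
    ∃ w, IsOrbit R w ∧ e ∈ w := by
  classical
  have := Fintype.ofFinite α
  let p : ℕ → Prop := fun n => ∃ w : List α, w.IsChain R ∧ w.Nodup ∧ e ∈ w ∧ w.length = n
  have hp1 : p 1 := ⟨[e], by simp⟩
  have hbound : ∀ n, p n → n ≤ Fintype.card α := by
    rintro n ⟨w, -, hn, -, rfl⟩
    exact hn.length_le_card
  obtain ⟨w, hc, hn, he, hlen⟩ := Nat.findGreatest_spec (hbound 1 hp1) hp1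
  have hmax : ∀ w' : List α, w'.IsChain R → w'.Nodup → e ∈ w' → w'.length ≤ w.length := by
    intro w' h1 h2 h3
    rw [hlen]
    exact Nat.le_findGreatest (hbound _ ⟨w', h1, h2, h3, rfl⟩) ⟨w', h1, h2, h3, rfl⟩
  have hne : w ≠ [] := List.ne_nil_of_mem he
  refine ⟨w, ⟨hne, hc, hn, ?_⟩, he⟩
  by_cases hs : ∃ x ∈ w.getLast?, ∃ y, R x y
  · left
    obtain ⟨x, hx, y, hxy⟩ := hs
    have hy : y ∈ w := by
      by_contra hy
      have := hmax (w ++ [y])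
        (List.isChain_append.2 ⟨hc, by simp, fun x' hx' y' hy' => by
          obtain rfl : x = x' := Option.mem_unique hx hx'
          obtain rfl : y = y' := by simpa using hy'
          exact hxy⟩)
        (by simpa [List.nodup_append] using ⟨hn, fun a ha h => hy (h ▸ ha)⟩) (by simp [he])
      simp at this
    obtain ⟨s, t, rfl⟩ := List.append_of_mem hy
    rcases List.eq_nil_or_concat s with rfl | ⟨s, q, rfl⟩
    · intro x' hx' y' hy'
      obtain rfl : x = x' := Option.mem_unique hx hx'
      obtain rfl : y = y' := by simpa using hy'
      exact hxy
    · exfalso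
      have hq : R q y := (List.isChain_append.1 hc).2.2 q (by simp) y (by simp)
      obtain rfl := hR.1 hq hxy
      rw [List.getLast?_append_of_ne_nil _ (by simp)] at hx
      exact (List.nodup_append.1 hn).2.2 q (by simp) q (List.mem_of_getLast? hx) rfl
  by_cases hs' : ∃ y ∈ w.head?, ∃ x, R x y
  · exfalso
    obtain ⟨y, hy, x, hxy⟩ := hs'
    have hx : x ∈ w := by
      by_contra hx
      have := hmax (x :: w)
        (List.isChain_cons.2 ⟨fun y' hy' => by
          obtain rfl : y = y' := Option.mem_unique hy hy'
          exact hxy, hc⟩)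
        (by simp [hx, hn]) (by simp [he])
      simp at this
    obtain ⟨s, t, rfl⟩ := List.append_of_mem hx
    rcases t with _ | ⟨z, t⟩
    · exact hs ⟨x, by simp, y, hxy⟩
    · have hz : R x z := (List.isChain_cons_cons.1 (List.isChain_append.1 hc).2.1).1
      obtain rfl := hR.2 hz hxy
      rcases s with _ | ⟨b, s⟩
      · obtain rfl : x = z := by simpa using hy
        simp at hn
      · obtain rfl : b = z := by simpa using hy
        simp at hn
  · right
    push Not at hs hs'
    exact ⟨hs', hs⟩

end Orbits

variable {tl hd : E → V} {col : E → Col}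

/-- Consecutive edges of the same colour. -/
def MonoStep (tl hd : E → V) (col : E → Col) (e f : E) : Prop :=
  hd e = tl f ∧ col e = col f

theorem isInternal_of_hd_eq_tl {e f : E} (h : hd e = tl f) : IsInternal tl hd (hd e) :=
  ⟨fun hs => hs e rfl, fun hs => hs f h.symm⟩

theorem CyclicAmpleFraming.existsUnique_in (hfr : CyclicAmpleFraming tl hd col) {v : V}
    (hv : IsInternal tl hd v) (c : Col) : ∃! e, hd e = v ∧ col e = c := by
  cases c
  · exact (hfr.1 v hv).1
  · exact (hfr.1 v hv).2.1

theorem CyclicAmpleFraming.existsUnique_out (hfr : CyclicAmpleFraming tl hd col) {v : V}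
    (hv : IsInternal tl hd v) (c : Col) : ∃! e, tl e = v ∧ col e = c := by
  cases c
  · exact (hfr.1 v hv).2.2.1
  · exact (hfr.1 v hv).2.2.2

theorem CyclicAmpleFraming.biUnique (hfr : CyclicAmpleFraming tl hd col) :
    Relator.BiUnique (MonoStep tl hd col) := by
  constructor
  · intro e f g h h'
    have hi := isInternal_of_hd_eq_tl h.1
    exact (hfr.existsUnique_in hi (col e)).unique ⟨rfl, rfl⟩
      ⟨h'.1.trans h.1.symm, h'.2.trans h.2.symm⟩
  · intro e f g h h'
    have hi := isInternal_of_hd_eq_tl h.1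
    exact (hfr.existsUnique_out hi (col e)).unique ⟨h.1.symm, h.2.symm⟩ ⟨h'.1.symm, h'.2.symm⟩

theorem CyclicAmpleFraming.isSink_of_no_succ (hfr : CyclicAmpleFraming tl hd col) {e : E}
    (h : ∀ f, ¬ MonoStep tl hd col e f) : IsSink tl hd (hd e) := by
  by_contra hs
  obtain ⟨f, hf, -⟩ := hfr.existsUnique_out ⟨fun h => h e rfl, hs⟩ (col e)
  exact h f ⟨hf.1.symm, hf.2.symm⟩

theorem CyclicAmpleFraming.isSource_of_no_pred (hfr : CyclicAmpleFraming tl hd col) {e : E}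
    (h : ∀ f, ¬ MonoStep tl hd col f e) : IsSource tl hd (tl e) := by
  by_contra hs
  obtain ⟨f, hf, -⟩ := hfr.existsUnique_in ⟨hs, fun h => h e rfl⟩ (col e)
  exact h f ⟨hf.1, hf.2⟩

theorem isChain_monoStep {w : List E} (hw : IsWalk tl hd w) (hm : Mono col w) :
    w.IsChain (MonoStep tl hd col) := by
  obtain ⟨c, hc⟩ := hm
  have h : w.IsChain fun e f => hd e = tl f := hw.2
  rw [List.isChain_iff_getElem] at h ⊢
  exact fun i hi => ⟨h i hi, by rw [hc _ (List.getElem_mem _), hc _ (List.getElem_mem _)]⟩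

/-- The monochromatic routes are the orbits of `MonoStep`. -/
theorem CyclicAmpleFraming.isOrbit_iff (hfr : CyclicAmpleFraming tl hd col) {w : List E} :
    IsOrbit (MonoStep tl hd col) w ↔ IsRoute tl hd w ∧ Mono col w := by
  constructor
  · rintro ⟨hne, hc, hn, hends⟩
    have hwalk : IsWalk tl hd w := ⟨hne, hc.imp fun _ _ h => h.1⟩
    have hm : Mono col w := by
      refine ⟨col (w.head hne), fun f hf => ?_⟩
      exact forall_mem_of_isChain (P := fun f => col f = col (w.head hne))
        (fun x y h => by rw [h.2]) hc (List.head_mem hne) hf rfl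
    refine ⟨?_, hm⟩
    rcases hends with h | h
    · left
      refine ⟨hwalk, fun x hx y hy => (h x hx y hy).1, hn.map_on fun x hx y hy hxy => ?_⟩
      have hw : IsOrbit (MonoStep tl hd col) w := ⟨hne, hc, hn, Or.inl h⟩
      obtain ⟨c, hcol⟩ := hm
      have hi : IsInternal tl hd (hd x) := by
        obtain ⟨s, t, rfl⟩ := List.append_of_mem hx
        rcases t with _ | ⟨z, t⟩
        · exact isInternal_of_hd_eq_tl (h x (by simp) _ (List.head_mem_head? hne)).1
        · exact isInternal_of_hd_eq_tl
            (List.isChain_cons_cons.1 (List.isChain_append.1 hc).2.1).1.1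
      exact (hfr.existsUnique_in hi c).unique ⟨rfl, hcol x hx⟩ ⟨hxy.symm, hcol y hy⟩
    · exact Or.inr ⟨hwalk, fun y hy => hfr.isSource_of_no_pred (h.1 y hy),
        fun x hx => hfr.isSink_of_no_succ (h.2 x hx)⟩
  · rintro ⟨⟨hwalk, hcl, hn⟩ | ⟨hwalk, hsrc, hsnk⟩, hm⟩
    · refine ⟨hwalk.1, isChain_monoStep hwalk hm, hn.of_map, Or.inl fun x hx y hy => ?_⟩
      obtain ⟨c, hc⟩ := hm
      exact ⟨hcl x hx y hy,
        by rw [hc x (List.mem_of_getLast? hx), hc y (List.mem_of_head? hy)]⟩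
    · have h0 : ∀ y ∈ w.head?, ∀ x, ¬ MonoStep tl hd col x y :=
        fun y hy x h => hsrc y hy x h.1
      have hc := isChain_monoStep hwalk hm
      exact ⟨hwalk.1, hc, nodup_of_isChain_of_no_pred hfr.biUnique hc h0,
        Or.inr ⟨h0, fun x hx y h => hsnk x hx y h.1.symm⟩⟩

theorem CyclicAmpleFraming.not_mono_of_isMinCycle_infix (hfr : CyclicAmpleFraming tl hd col)
    {w u : List E} (hw : IsSrcSnkWalk tl hd w) (huw : u <:+: w) (hu : IsMinCycle tl hd u) :
    ¬ Mono col w := by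
  intro hm
  obtain ⟨-, hc, hn, -⟩ := hfr.isOrbit_iff.2 ⟨Or.inr hw, hm⟩
  obtain ⟨s, t, rfl⟩ := huw
  obtain ⟨c, hcol⟩ := hm
  have hne := hu.1.1
  have hx := List.getLast_mem_getLast? hne
  have hy := List.head_mem_head? hne
  have hxu := List.getLast_mem hne
  have hyu := List.head_mem hne
  generalize u.getLast hne = x at hx hxu
  generalize u.head hne = y at hy hyu
  have hxy : MonoStep tl hd col x y :=
    ⟨hu.2.1 x hx y hy, by rw [hcol x (by simp [hxu]), hcol y (by simp [hyu])]⟩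
  rcases t with _ | ⟨z, t⟩
  · refine hw.2.2 x ?_ y hxy.1.symm
    rw [List.append_nil, List.getLast?_append_of_ne_nil _ hne]
    exact hx
  · have hxz : MonoStep tl hd col x z := by
      refine (List.isChain_append.1 hc).2.2 x ?_ z (by simp)
      rw [List.getLast?_append_of_ne_nil _ hne]
      exact hx
    obtain rfl := hfr.biUnique.2 hxy hxz
    exact (List.nodup_append.1 hn).2.2 y (by simp [hyu]) y (by simp) rfl

/-- with a cyclic ample framing, every monochromatic route is a
minimal directed cycle or a good route (no bad route is monochromatic), and
every edge lies in exactly one monochromatic route (uniqueness up to rotation,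
since minimal cycles are identified up to cyclic rotation). -/
theorem statement3 {V E : Type*} [Fintype V] [Fintype E] (tl hd : E → V) (col : E → Col)
    (hconn : Connected tl hd) (hdeg : DegreeOneEnds tl hd) (hidle : NoIdleEdges tl hd)
    (hfr : CyclicAmpleFraming tl hd col) :
    (∀ w : List E, IsRoute tl hd w → Mono col w →
      IsMinCycle tl hd w ∨ IsGoodRoute tl hd w) ∧
    (∀ w : List E, IsSrcSnkWalk tl hd w →
      (∃ u : List E, u <:+: w ∧ IsMinCycle tl hd u) → ¬ Mono col w) ∧
    (∀ e : E, ∃ w : List E, IsRoute tl hd w ∧ Mono col w ∧ e ∈ w ∧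
      ∀ w' : List E, IsRoute tl hd w' → Mono col w' → e ∈ w' → List.IsRotated w' w) := by
  refine ⟨fun w hw hm => ?_, ?_, fun e => ?_⟩
  · exact hw.imp_right fun h =>
      ⟨h, fun u huw hu => hfr.not_mono_of_isMinCycle_infix h huw hu hm⟩
  · rintro w hw ⟨u, huw, hu⟩
    exact hfr.not_mono_of_isMinCycle_infix hw huw hu
  · obtain ⟨w, hw, he⟩ := exists_isOrbit hfr.biUnique e
    obtain ⟨hr, hm⟩ := hfr.isOrbit_iff.1 hw
    exact ⟨w, hr, hm, he, fun w' hr' hm' he' =>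
      hw.isRotated hfr.biUnique (hfr.isOrbit_iff.2 ⟨hr', hm'⟩) he he'⟩

end PaperDKK
end

section
/- Let p ≥ 2 and let a = (a_1,…,a_p) be a tuple of nonnegative integers. The number of cyclic integer flows on H_{1,p} whose netflow at the source (0,b) equals a_b for every b ∈ {1,…,p} is binom(a_1 + ⋯ + a_p + 2p − 2, p − 1). -/
namespace PaperDKK

variable {V E : Type*}

/-- The edge set of a minimal directed cycle (minimal cycles are identified up
to cyclic rotation, hence with their edge sets). -/
def IsCycleSet (tl hd : E → V) [DecidableEq E] (C : Finset E) : Prop :=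
  ∃ w : List E, IsMinCycle tl hd w ∧ w.toFinset = C

/-- The routes of the graph: minimal directed cycles (up to rotation, i.e. as
edge sets) together with good routes. -/
abbrev RoutesT (tl hd : E → V) [DecidableEq E] : Type _ :=
  {C : Finset E // IsCycleSet tl hd C} ⊕ {w : List E // IsGoodRoute tl hd w}

/-- The indicator flow of a route: how many times the route traverses each edge. -/
def rInd (tl hd : E → V) [DecidableEq E] : RoutesT tl hd → E → ℝ
  | Sum.inl C => fun e => if e ∈ C.1 then 1 else 0
  | Sum.inr w => fun e => (w.1.count e : ℝ)

/-- Compatibility of routes: minimal cycles are compatible with everything;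
two good routes are compatible when they are not incompatible. -/
def RCompat (tl hd : E → V) [DecidableEq E] (col : E → Col) :
    RoutesT tl hd → RoutesT tl hd → Prop
  | Sum.inr w, Sum.inr w' => ¬ Incompat tl hd col w.1 w'.1
  | _, _ => True

/-- A clique: a set of routes that are pairwise compatible and each compatible
with itself. -/
def RClique (tl hd : E → V) [DecidableEq E] (col : E → Col)
    (K : Set (RoutesT tl hd)) : Prop :=
  ∀ r ∈ K, ∀ r' ∈ K, RCompat tl hd col r r'

/-- Netflow of a real flow at a vertex. -/
def netflowR (tl hd : E → V) [Fintype E] [DecidableEq V] (f : E → ℝ) (v : V) : ℝ :=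
  (∑ e ∈ Finset.univ.filter (fun e => tl e = v), f e) -
  (∑ e ∈ Finset.univ.filter (fun e => hd e = v), f e)

/-- Netflow of a natural-number flow at a vertex, as an integer. -/
def netflowN (tl hd : E → V) [Fintype E] [DecidableEq V] (f : E → ℕ) (v : V) : ℤ :=
  (∑ e ∈ Finset.univ.filter (fun e => tl e = v), (f e : ℤ)) -
  (∑ e ∈ Finset.univ.filter (fun e => hd e = v), (f e : ℤ))

/-- A cyclic integer flow: every minimal directed cycle has exactly one edge with
flow 0, and the netflow is 1 at every internal vertex except at the tails of
these zero edges, where it is 0. -/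
def IsCyclicIntFlow (tl hd : E → V) [Fintype E] [DecidableEq V] [DecidableEq E]
    (f : E → ℕ) : Prop :=
  (∀ C : Finset E, IsCycleSet tl hd C → ∃! e : E, e ∈ C ∧ f e = 0) ∧
  (∀ v : V, IsInternal tl hd v →
    ((∃ C : Finset E, IsCycleSet tl hd C ∧ ∃ e ∈ C, f e = 0 ∧ tl e = v) →
      netflowN tl hd f v = 0) ∧
    ((¬ ∃ C : Finset E, IsCycleSet tl hd C ∧ ∃ e ∈ C, f e = 0 ∧ tl e = v) →
      netflowN tl hd f v = 1))

/-- A cyclic volume integer flow: a cyclic integer flow with netflow 0 at every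
source. -/
def IsCyclicVolIntFlow (tl hd : E → V) [Fintype E] [DecidableEq V] [DecidableEq E]
    (f : E → ℕ) : Prop :=
  IsCyclicIntFlow tl hd f ∧ ∀ v : V, IsSource tl hd v → netflowN tl hd f v = 0

/-- Vertices of the graph `H_{c,p}` of `c` nested `p`-cycles:
`(a,b)` with `0 ≤ a ≤ c+1` and `b ∈ {1,…,p}` (here 0-indexed). -/
abbrev HVtx (c p : ℕ) : Type := Fin (c + 2) × Fin p

/-- Edges of `H_{c,p}` : vertical edges `(a,b) → (a+1,b)` for `0 ≤ a ≤ c`,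
and row-cycle edges `(a,b) → (a, b+1 mod p)` for `1 ≤ a ≤ c`. -/
abbrev HEdg (c p : ℕ) : Type := (Fin (c + 1) × Fin p) ⊕ (Fin c × Fin p)

/-- Successor mod `p`. -/
def finNext {p : ℕ} (b : Fin p) : Fin p :=
  ⟨(b.1 + 1) % p, Nat.mod_lt _ (Nat.lt_of_le_of_lt (Nat.zero_le _) b.isLt)⟩

def Htl (c p : ℕ) : HEdg c p → HVtx c p
  | Sum.inl (a, b) => (Fin.castSucc a, b)
  | Sum.inr (a, b) => (Fin.castSucc (Fin.succ a), b)

def Hhd (c p : ℕ) : HEdg c p → HVtx c p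
  | Sum.inl (a, b) => (Fin.succ a, b)
  | Sum.inr (a, b) => (Fin.castSucc (Fin.succ a), finNext b)

/-- The cyclic ample framing of `H_{c,p}` : row-cycle edges are red, all the
remaining edges are blue. -/
def Hcol (c p : ℕ) : HEdg c p → Col
  | Sum.inl _ => Col.blue
  | Sum.inr _ => Col.red

section ClosedWalks

variable {tl hd : E → V} {w : List E}

/-- Every edge of a closed walk is followed by an edge of the walk. -/
theorem IsMinCycle.exists_next (h : IsMinCycle tl hd w) {e : E} (he : e ∈ w) :
    ∃ f ∈ w, hd e = tl f := by
  obtain ⟨⟨hne, hc⟩, hclosed, -⟩ := h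
  obtain ⟨i, hi, rfl⟩ := List.getElem_of_mem he
  by_cases h : i + 1 < w.length
  · exact ⟨w[i + 1], List.getElem_mem h, List.isChain_iff_getElem.1 hc i h⟩
  · refine ⟨w.head hne, List.head_mem hne, hclosed _ ?_ _ (List.head?_eq_some_head hne)⟩
    obtain rfl : i = w.length - 1 := by omega
    rw [Option.mem_def, List.getLast?_eq_getElem?, List.getElem?_eq_getElem hi]

/-- Every edge of a closed walk is preceded by an edge of the walk. -/
theorem IsMinCycle.exists_prev (h : IsMinCycle tl hd w) {e : E} (he : e ∈ w) :
    ∃ f ∈ w, hd f = tl e := by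
  obtain ⟨⟨hne, hc⟩, hclosed, -⟩ := h
  obtain ⟨i, hi, rfl⟩ := List.getElem_of_mem he
  rcases i with _ | i
  · refine ⟨w.getLast hne, List.getLast_mem hne,
      hclosed _ (List.getLast?_eq_some_getLast hne) _ ?_⟩
    rw [Option.mem_def, List.head?_eq_getElem?, List.getElem?_eq_getElem hi]
  · exact ⟨w[i], List.getElem_mem _, List.isChain_iff_getElem.1 hc i hi⟩

end ClosedWalks

section Graph

variable {m : ℕ}

theorem finNext_eq_add_one (b : Fin (m + 1)) : finNext b = b + 1 := by
  ext
  simp [finNext, Fin.val_add]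

/-- The only minimal directed cycle of `H_{1,m+1}` is its row cycle. -/
theorem isCycleSet_iff (C : Finset (HEdg 1 (m + 1))) :
    IsCycleSet (Htl 1 (m + 1)) (Hhd 1 (m + 1)) C ↔
      C = Finset.univ.image fun b => Sum.inr (0, b) := by
  constructor
  · rintro ⟨w, hw, rfl⟩
    have hrow : ∀ e ∈ w, ∃ b, e = Sum.inr (0, b) := by
      rintro (⟨i, b⟩ | ⟨i, b⟩) he
      · fin_cases i
        · obtain ⟨(⟨j, c⟩ | ⟨j, c⟩), -, h⟩ := hw.exists_prev he <;>
            simpa [Hhd, Htl] using congrArg (fun v => v.1.val) h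
        · obtain ⟨(⟨j, c⟩ | ⟨j, c⟩), -, h⟩ := hw.exists_next he <;>
            (have := congrArg (fun v => v.1.val) h; simp [Hhd, Htl] at this; try omega)
      · exact ⟨b, by rw [Subsingleton.elim i 0]⟩
    have hstep : ∀ b, Sum.inr (0, b) ∈ w → Sum.inr (0, b + 1) ∈ w := by
      intro b hb
      obtain ⟨f, hf, h⟩ := hw.exists_next hb
      obtain ⟨c, rfl⟩ := hrow f hf
      have : finNext b = c := congrArg Prod.snd h
      rwa [← finNext_eq_add_one, this]
    obtain ⟨b, hb⟩ : ∃ b : Fin (m + 1), Sum.inr (0, b) ∈ w := by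
      obtain ⟨e, he⟩ := List.exists_mem_of_ne_nil w hw.1.1
      obtain ⟨b, rfl⟩ := hrow e he
      exact ⟨b, he⟩
    have hall : ∀ c, Sum.inr (0, c) ∈ w := by
      have hk : ∀ k : ℕ, Sum.inr (0, b + Fin.ofNat (m + 1) k) ∈ w := by
        intro k
        induction k with
        | zero => simpa using hb
        | succ k ih =>
          have : Fin.ofNat (m + 1) (k + 1) = Fin.ofNat (m + 1) k + 1 := by ext; simp [Fin.val_add]
          rw [this, ← add_assoc]
          exact hstep _ ih
      intro c
      simpa using hk (c - b).val
    ext e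
    simp only [List.mem_toFinset, Finset.mem_image, Finset.mem_univ, true_and]
    refine ⟨fun he => (hrow e he).imp fun _ h => h.symm, ?_⟩
    rintro ⟨c, rfl⟩
    exact hall c
  · rintro rfl
    refine ⟨List.ofFn fun b => Sum.inr (0, b), ⟨⟨by simp, ?_⟩, ?_, ?_⟩,
      by ext; simp [List.mem_ofFn', -List.ofFn_succ]⟩
    · refine List.isChain_iff_getElem.2 fun i hi => ?_
      rw [List.length_ofFn] at hi
      simp [Hhd, Htl, finNext, Nat.mod_eq_of_lt hi, -List.ofFn_succ]
    · intro e he f hf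
      rw [Option.mem_def, List.getLast?_eq_getElem?, List.getElem?_eq_getElem (by simp)] at he
      rw [Option.mem_def, List.head?_eq_getElem?, List.getElem?_eq_getElem (by simp)] at hf
      simp only [Option.some.injEq] at he hf
      subst he hf
      simp [Hhd, Htl, finNext, -List.ofFn_succ]
    · rw [List.map_ofFn, List.nodup_ofFn]
      intro b c h
      have : finNext b = finNext c := congrArg Prod.snd h
      simpa [finNext_eq_add_one] using this

theorem isInternal_iff (v : HVtx 1 (m + 1)) :
    IsInternal (Htl 1 (m + 1)) (Hhd 1 (m + 1)) v ↔ v.1 = 1 := by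
  obtain ⟨i, b⟩ := v
  simp only [IsInternal, IsSource, IsSink, not_forall, not_not]
  constructor
  · rintro ⟨⟨(⟨j, c⟩ | ⟨j, c⟩), h⟩, ⟨(⟨j', c'⟩ | ⟨j', c'⟩), h'⟩⟩ <;>
      simp [Hhd, Htl, Fin.ext_iff] at h h' ⊢ <;> omega
  · rintro rfl
    exact ⟨⟨Sum.inl (0, b), rfl⟩, ⟨Sum.inl (1, b), rfl⟩⟩

theorem netflowN_source (f : HEdg 1 (m + 1) → ℕ) (b : Fin (m + 1)) :
    netflowN (Htl 1 (m + 1)) (Hhd 1 (m + 1)) f ((0 : Fin 3), b) = f (Sum.inl (0, b)) := by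
  simp only [netflowN, Finset.sum_filter, Fintype.sum_sum_type, Fintype.sum_prod_type,
    Fin.sum_univ_one]
  simp [Htl, Hhd]

theorem netflowN_internal (f : HEdg 1 (m + 1) → ℕ) (b : Fin (m + 1)) :
    netflowN (Htl 1 (m + 1)) (Hhd 1 (m + 1)) f ((1 : Fin 3), b) =
      f (Sum.inl (1, b)) + f (Sum.inr (0, b)) - (f (Sum.inl (0, b)) + f (Sum.inr (0, b - 1))) := by
  simp only [netflowN, Finset.sum_filter, Fintype.sum_sum_type, Fintype.sum_prod_type,
    Fin.sum_univ_one]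
  simp [Htl, Hhd, finNext_eq_add_one, ← eq_sub_iff_add_eq]

/-- Cyclic integer flows of `H_{1,m+1}` in coordinates. -/
theorem isCyclicIntFlow_iff (f : HEdg 1 (m + 1) → ℕ) :
    IsCyclicIntFlow (Htl 1 (m + 1)) (Hhd 1 (m + 1)) f ↔
      (∃! b, f (Sum.inr (0, b)) = 0) ∧
      ∀ b, f (Sum.inl (1, b)) + f (Sum.inr (0, b)) + (if f (Sum.inr (0, b)) = 0 then 1 else 0) =
        f (Sum.inl (0, b)) + f (Sum.inr (0, b - 1)) + 1 := by
  simp only [IsCyclicIntFlow, isCycleSet_iff, isInternal_iff, forall_eq, exists_eq_left]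
  refine and_congr ?_ ?_
  · simp only [ExistsUnique, Finset.mem_image, Finset.mem_univ, true_and]
    constructor
    · rintro ⟨_, ⟨⟨b, rfl⟩, hb⟩, h⟩
      exact ⟨b, hb, fun c hc => by simpa using h _ ⟨⟨c, rfl⟩, hc⟩⟩
    · rintro ⟨b, hb, h⟩
      refine ⟨_, ⟨⟨b, rfl⟩, hb⟩, ?_⟩
      rintro _ ⟨⟨c, rfl⟩, hc⟩
      rw [h c hc]
  · have key : ∀ b, (∃ e ∈ Finset.univ.image fun c : Fin (m + 1) =>
        (Sum.inr (0, c) : HEdg 1 (m + 1)), f e = 0 ∧ Htl 1 (m + 1) e = ((1 : Fin 3), b)) ↔ f (Sum.inr (0, b)) = 0 := by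
      intro b
      simp [Htl]
    constructor
    · intro h b
      have := h (1, b) rfl
      rw [key, netflowN_internal] at this
      split_ifs with h0
      · have := this.1 h0
        omega
      · have := this.2 h0
        omega
    · rintro h ⟨_, b⟩ rfl
      have := h b
      rw [key, netflowN_internal]
      split_ifs at this with h0 <;> simp only [h0] <;> simp <;> omega

end Graph

section CycleLemma

variable {m : ℕ} {a y z : Fin (m + 1) → ℕ}

theorem sum_eq_of_isCircularFlow (hy : ∃! b, y b = 0)
    (h : ∀ b, z b + y b + (if y b = 0 then 1 else 0) = a b + y (b - 1) + 1) :
    ∑ b, z b = ∑ b, a b + m := by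
  obtain ⟨b₀, h0, hu⟩ := hy
  have hiff : ∀ b, y b = 0 ↔ b = b₀ := fun b => ⟨hu b, fun h => h ▸ h0⟩
  have hshift : ∑ b, y (b - 1) = ∑ b, y b := (Equiv.subRight (1 : Fin (m + 1))).sum_comp y
  have := Finset.sum_congr rfl fun b (_ : b ∈ Finset.univ) => h b
  simp only [Finset.sum_add_distrib, hiff, hshift] at this
  simp at this
  omega

/-- Cycle lemma: the flow along a directed cycle, vanishing on exactly one edge, is determined
by the inflows `a` and outflows `z`, subject only to the conservation of the total flow. -/
theorem existsUnique_circularFlow (a z : Fin (m + 1) → ℕ) (h : ∑ b, z b = ∑ b, a b + m) :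
    ∃! y : Fin (m + 1) → ℕ, (∃! b, y b = 0) ∧
      ∀ b, z b + y b + (if y b = 0 then 1 else 0) = a b + y (b - 1) + 1 := by
  set g : Fin (m + 1) → ℤ := fun b => a b + 1 - z b with hg
  obtain ⟨P, hP0, hPs, hPl⟩ : ∃ P : Fin (m + 1) → ℤ, P 0 = g 0 ∧
      (∀ i : Fin m, P i.succ = P i.castSucc + g i.succ) ∧ P (Fin.last m) = 1 := by
    refine ⟨fun b => Fin.partialSum g b.succ, ?_, fun i => ?_, ?_⟩
    · simpa using Fin.partialSum_succ g 0
    · simpa only [Fin.succ_castSucc] using Fin.partialSum_succ g i.succ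
    · simp only [Fin.partialSum]
      rw [List.take_of_length_le (by simp), List.sum_ofFn]
      have : (∑ b, (z b : ℤ)) = ∑ b, (a b : ℤ) + m := mod_cast h
      simp [hg, Finset.sum_sub_distrib, Finset.sum_add_distrib, this]
  have pred_zero : (0 : Fin (m + 1)) - 1 = Fin.last m := by
    rw [sub_eq_iff_eq_add, Fin.last_add_one]
  have pred_succ : ∀ i : Fin m, i.succ - 1 = i.castSucc := by
    intro i
    rw [sub_eq_iff_eq_add, Fin.coeSucc_eq_succ]
  obtain ⟨b₀, hlt, hgt⟩ : ∃ b₀, (∀ b < b₀, P b₀ ≤ P b) ∧ ∀ b, b₀ < b → P b₀ < P b := by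
    obtain ⟨b₀, -, hb⟩ := Finset.exists_min_image Finset.univ
      (fun b => toLex (P b, OrderDual.toDual b)) Finset.univ_nonempty
    simp only [Finset.mem_univ, true_imp_iff, Prod.Lex.toLex_le_toLex, OrderDual.toDual_le_toDual]
      at hb
    refine ⟨b₀, fun b h => ?_, fun b h => ?_⟩ <;> have := hb b <;> omega
  have hflow : ∀ y : Fin (m + 1) → ℕ, ∀ b₁, (∀ b, y b = 0 ↔ b = b₁) →
      ((∀ b, z b + y b + (if y b = 0 then 1 else 0) = a b + y (b - 1) + 1) ↔
        ∀ b, (y b : ℤ) = P b - P b₁ + if b < b₁ then 1 else 0) := by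
    intro y b₁ hy
    have hy1 := (hy b₁).2 rfl
    simp only [hy]
    constructor
    · intro H
      have hind : ∀ b, (y b : ℤ) = y (Fin.last m) + P b - if b < b₁ then 0 else 1 := by
        intro b
        induction b using Fin.induction with
        | zero =>
          have := H 0
          rw [pred_zero] at this
          simp only [hP0, hg]
          split_ifs at this ⊢ <;> grind
        | succ i ih =>
          have := H i.succ
          rw [pred_succ] at this
          simp only [hPs, hg]
          grind
      intro b
      have h1 := hind b₁
      have h2 := hind b
      rw [if_neg (lt_irrefl _)] at h1
      split_ifs at h2 ⊢ <;> omega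
    · intro H b
      have hb := H b
      have hl : (y (Fin.last m) : ℤ) = P (Fin.last m) - P b₁ := by
        rw [H, if_neg (not_lt.2 (Fin.le_last _)), add_zero]
      induction b using Fin.cases with
      | zero =>
        rw [pred_zero]
        simp only [hP0, hg] at hb
        split_ifs at hb ⊢ <;> grind
      | succ i =>
        have hi := H i.castSucc
        rw [pred_succ]
        simp only [hPs, hg] at hb
        split_ifs at hb hi ⊢ <;> grind
  refine ⟨fun b => (P b - P b₀ + if b < b₀ then 1 else 0).toNat, ?_, ?_⟩
  · have hpos : ∀ b, 0 ≤ P b - P b₀ + if b < b₀ then 1 else 0 := by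
      intro b
      rcases lt_trichotomy b b₀ with hb | rfl | hb
      · simp only [hb, if_true]; have := hlt b hb; omega
      · simp
      · simp only [hb.not_gt, if_false]; have := hgt b hb; omega
    have hz : ∀ b, (P b - P b₀ + if b < b₀ then 1 else 0).toNat = 0 ↔ b = b₀ := by
      intro b
      rcases lt_trichotomy b b₀ with hb | rfl | hb
      · simp only [hb, if_true, hb.ne, Int.toNat_eq_zero, iff_false]; have := hlt b hb; omega
      · simp
      · simp only [hb.not_gt, if_false, hb.ne', Int.toNat_eq_zero, iff_false]
        have := hgt b hb
        omega
    refine ⟨⟨b₀, (hz b₀).2 rfl, fun b => (hz b).1⟩, ?_⟩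
    exact (hflow _ b₀ hz).2 fun b => Int.toNat_of_nonneg (hpos b)
  · rintro y ⟨⟨b₁, h1, hu⟩, hy⟩
    have hz : ∀ b, y b = 0 ↔ b = b₁ := fun b => ⟨hu b, fun h => h ▸ h1⟩
    have H := (hflow y b₁ hz).1 hy
    obtain rfl : b₁ = b₀ := by
      have h0 := H b₀
      rcases lt_trichotomy b₀ b₁ with hb | hb | hb
      · have := hgt b₁ hb
        have := (hz b₀).not.2 hb.ne
        rw [if_pos hb] at h0
        omega
      · exact hb.symm
      · have := hlt b₁ hb
        have := (hz b₀).not.2 hb.ne'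
        rw [if_neg hb.not_gt] at h0
        omega
    funext b
    rw [← H b, Int.toNat_natCast]

theorem ncard_setOf_sum_eq (m n : ℕ) :
    {z : Fin (m + 1) → ℕ | ∑ b, z b = n}.ncard = (m + n).choose n := by
  have := Finset.card_finsuppAntidiag_nat_eq_choose (s := (Finset.univ : Finset (Fin (m + 1)))) n
  rw [← Set.ncard_coe_finset, Finset.card_fin, show m + 1 + n - 1 = m + n by omega] at this
  rw [← this, ← Set.ncard_image_of_injective _
    (DFunLike.coe_injective (F := Fin (m + 1) →₀ ℕ))]
  congr 1
  ext z
  simp only [Set.mem_ofPred_eq, Set.mem_image, Finset.mem_coe, Finset.mem_finsuppAntidiag]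
  refine ⟨fun h => ⟨Finsupp.equivFunOnFinite.symm z, ⟨h, by simp⟩, rfl⟩, ?_⟩
  rintro ⟨f, ⟨h, -⟩, rfl⟩
  exact h

end CycleLemma

/-- the number of cyclic integer flows on `H_{1,p}` whose netflow
at the source `(0,b)` equals `a b` for every `b` is
`binom(a₁ + ⋯ + a_p + 2p − 2, p − 1)`. -/
theorem statement11 (p : ℕ) (hp : 2 ≤ p) (a : Fin p → ℕ) :
    {f : HEdg 1 p → ℕ | IsCyclicIntFlow (Htl 1 p) (Hhd 1 p) f ∧
        ∀ b : Fin p, netflowN (Htl 1 p) (Hhd 1 p) f ((0 : Fin 3), b) = (a b : ℤ)}.ncard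
      = Nat.choose ((∑ b : Fin p, a b) + 2 * p - 2) (p - 1) := by
  obtain ⟨m, rfl⟩ : ∃ m, p = m + 1 := ⟨p - 1, by omega⟩
  have hbij : Set.BijOn (fun (f : HEdg 1 (m + 1) → ℕ) b => f (Sum.inl (1, b)))
      {f | IsCyclicIntFlow (Htl 1 (m + 1)) (Hhd 1 (m + 1)) f ∧
        ∀ b, netflowN (Htl 1 (m + 1)) (Hhd 1 (m + 1)) f ((0 : Fin 3), b) = (a b : ℤ)}
      {z | ∑ b, z b = ∑ b, a b + m} := by
    simp only [isCyclicIntFlow_iff, netflowN_source, Nat.cast_inj]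
    refine ⟨?_, ?_, ?_⟩
    · rintro f ⟨⟨hf, hz⟩, ha⟩
      simp only [ha] at hz
      exact sum_eq_of_isCircularFlow hf hz
    · rintro f ⟨⟨hf, hz⟩, ha⟩ f' ⟨⟨hf', hz'⟩, ha'⟩ (h : (fun b => _) = fun b => _)
      have h0 : ∀ b, f (Sum.inl (1, b)) = f' (Sum.inl (1, b)) := congrFun h
      have hs : ∑ b, f (Sum.inl (1, b)) = ∑ b, a b + m := by
        simp only [ha] at hz
        exact sum_eq_of_isCircularFlow hf hz
      have hy := (existsUnique_circularFlow a (fun b => f (Sum.inl (1, b))) hs).unique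
        (y₁ := fun b => f (Sum.inr (0, b))) (y₂ := fun b => f' (Sum.inr (0, b)))
        ⟨hf, by simpa only [ha] using hz⟩ ⟨hf', by simpa only [ha', h0] using hz'⟩
      ext (⟨i, b⟩ | ⟨i, b⟩)
      · fin_cases i
        · exact (ha b).trans (ha' b).symm
        · exact h0 b
      · obtain rfl := Subsingleton.elim i 0
        exact congrFun hy b
    · intro z hz
      obtain ⟨y, ⟨hy, hzy⟩, -⟩ := existsUnique_circularFlow a z hz
      exact ⟨Sum.elim (fun e => if e.1 = 0 then a e.2 else z e.2) fun e => y e.2,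
        ⟨⟨hy, by simpa using hzy⟩, by simp⟩, by simp⟩
  rw [← hbij.injOn.ncard_image, hbij.image_eq, ncard_setOf_sum_eq]
  rw [show m + (∑ b, a b + m) = ∑ b, a b + 2 * (m + 1) - 2 by omega, Nat.add_sub_cancel]
  exact Nat.choose_symm_of_eq_add (by omega)

end PaperDKK
end

section
/- For every c ≥ 1 and every k ≥ 1, the number of k-element sets of arc diagrams on {0,…,c+1} that are pairwise stacked (pairwise nested bipartitions) equals the number of k-element sets of arc diagrams on {0,…,c+1} that pairwise neither cross nor interfere. (This identity expresses that the c-dimensional mutoperhedron and the permutohedron Π_{c+1} have the same f-vector.) -/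
namespace PaperDKK

/-- A signed arc on `{0,…,c+1}` : `(i, j, σ)` with `i < j` and a sign
(`true` = `+`, i.e. top; `false` = `−`, i.e. bottom). -/
abbrev SArc : Type := ℕ × ℕ × Bool

/-- Validity of an arc on `{0,…,c+1}`. -/
def ValidArc (c : ℕ) (x : SArc) : Prop := x.1 < x.2.1 ∧ x.2.1 ≤ c + 1

/-- An arc diagram on `{0,…,c+1}` : a sequence of arcs
`(0,i_1,σ_1), (i_1,i_2,σ_2), …, (i_{ℓ−1}, c+1, σ_ℓ)` with alternating signs. -/
def IsArcDiagram (c : ℕ) (d : List SArc) : Prop :=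
  d ≠ [] ∧
  (∀ x ∈ d.head?, x.1 = 0) ∧
  (∀ x ∈ d.getLast?, x.2.1 = c + 1) ∧
  List.Chain' (fun x y => x.2.1 = y.1 ∧ x.2.2 ≠ y.2.2) d ∧
  ∀ x ∈ d, x.1 < x.2.1

/-- Two arcs of the same sign cross if they interleave: `i < k ≤ j < l`. -/
def Cross (x y : SArc) : Prop :=
  x.2.2 = y.2.2 ∧
  ((x.1 < y.1 ∧ y.1 ≤ x.2.1 ∧ x.2.1 < y.2.1) ∨
   (y.1 < x.1 ∧ x.1 ≤ y.2.1 ∧ y.2.1 < x.2.1))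

/-- Two arc diagrams cross if some arc of one crosses some arc of the other. -/
def DiagCross (d₁ d₂ : List SArc) : Prop := ∃ x ∈ d₁, ∃ y ∈ d₂, Cross x y

/-- Two arc diagrams interfere if they contain segments
`(a,i_0)^{σ_0}, (i_0,i_1)^{σ_1}, …, (i_{k−1},i_k)^{σ_k}, (i_k,b)^{σ_{k+1}}` and
`(a′,i_0)^{σ_0}, (i_0,i_1)^{σ_1}, …, (i_{k−1},i_k)^{σ_k}, (i_k,b′)^{σ_{k+1}}`
with the same middle part, `a < a′` and `b < b′`. -/
def Interfere (d₁ d₂ : List SArc) : Prop :=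
  ∃ (M : List SArc) (a a' b b' i j : ℕ) (σ τ : Bool),
    a < a' ∧ b < b' ∧
    ((a, i, σ) :: (M ++ [(j, b, τ)])) <:+: d₁ ∧
    ((a', i, σ) :: (M ++ [(j, b', τ)])) <:+: d₂

/-- The `A`-part of the bipartition of an arc diagram: the gaps `g` covered by a
`+` (top) arc. -/
def Apart (c : ℕ) (d : List SArc) : Finset ℕ :=
  (Finset.Icc 1 (c + 1)).filter (fun g => ∃ x ∈ d, x.2.2 = true ∧ x.1 < g ∧ g ≤ x.2.1)

/-- A multiset of arc diagrams is stacked iff the bipartitions of its members are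
pairwise nested, i.e. their `A`-parts are pairwise comparable under inclusion. -/
def Stacked (c : ℕ) (D : Multiset (List SArc)) : Prop :=
  ∀ d₁ ∈ D, ∀ d₂ ∈ D, Apart c d₁ ⊆ Apart c d₂ ∨ Apart c d₂ ⊆ Apart c d₁

/-- Consistency of a multiset of signed arcs: valid non-crossing arcs such that
at each `x ∈ {1,…,c}` the number of incoming arcs equals the number of outgoing
arcs (with multiplicity). -/
def Consistent (c : ℕ) (A : Multiset SArc) : Prop :=
  (∀ x ∈ A, ValidArc c x) ∧
  (∀ x ∈ A, ∀ y ∈ A, ¬ Cross x y) ∧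
  ∀ g : ℕ, 1 ≤ g → g ≤ c →
    Multiset.card (A.filter (fun x => x.2.1 = g)) =
      Multiset.card (A.filter (fun x => x.1 = g))

/-- The rank of a multiset of arcs: the number of arcs with left endpoint `0`
(with multiplicity). -/
def arcRank (A : Multiset SArc) : ℕ := Multiset.card (A.filter (fun x => x.1 = 0))

/-- The multiset union of the arcs of a multiset of arc diagrams. -/
def arcsOf (D : Multiset (List SArc)) : Multiset SArc :=
  D.bind (fun l => (l : Multiset SArc))


/-- A compatibility relation `R` on words of equal length that is built letter by letter: two words
extended by distinct letters stay compatible iff the extension is monotone for `le`, and `le` is a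
linear order on every clique of `R`. -/
structure IsCutRelation (R le : List Bool → List Bool → Prop) : Prop where
  nil : R [] []
  cons_iff : ∀ {u v : List Bool}, u.length = v.length → ∀ s t : Bool,
    R (s :: u) (t :: v) ↔
      R u v ∧ (s = false → t = true → le u v) ∧ (s = true → t = false → le v u)
  refl : ∀ u, le u u
  antisymm : ∀ {u v : List Bool}, u.length = v.length → le u v → le v u → u = v
  trans : ∀ {u v w : List Bool}, le u v → le v w → le u w
  total : ∀ {u v : List Bool}, u.length = v.length → R u v → le u v ∨ le v u

/-- The words of length `n`. -/
noncomputable def words (n : ℕ) : Finset (List Bool) := (List.finite_length_eq Bool n).toFinset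

@[simp]
theorem mem_words {n : ℕ} {w : List Bool} : w ∈ words n ↔ w.length = n := by
  simp [words]

open Classical in
/-- The cliques of `R` among the words of length `n`. -/
noncomputable def cliques (R : List Bool → List Bool → Prop) (n : ℕ) :
    Finset (Finset (List Bool)) :=
  (words n).powerset.filter fun T => ∀ u ∈ T, ∀ v ∈ T, R u v

theorem mem_cliques {R : List Bool → List Bool → Prop} {n : ℕ} {T : Finset (List Bool)} :
    T ∈ cliques R n ↔ (∀ u ∈ T, u.length = n) ∧ ∀ u ∈ T, ∀ v ∈ T, R u v := by
  simp [cliques, Finset.subset_iff]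

/-- The ways to attach letters to the elements of an `m`-element chain, monotonically and with at
least one letter per element. -/
def cuts (m : ℕ) : Finset (Finset (Bool × Fin m)) :=
  Finset.univ.filter fun V =>
    V.image Prod.snd = Finset.univ ∧ ∀ a b, (false, a) ∈ V → (true, b) ∈ V → a ≤ b

theorem exists_equiv_fin_le_iff {α : Type*} [Fintype α] {r : α → α → Prop} (hrefl : ∀ a, r a a)
    (htrans : ∀ a b c, r a b → r b c → r a c) (hanti : ∀ a b, r a b → r b a → a = b)
    (htotal : ∀ a b, r a b ∨ r b a) {m : ℕ} (hm : Fintype.card α = m) :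
    ∃ e : Fin m ≃ α, ∀ i j, i ≤ j ↔ r (e i) (e j) := by
  let : LinearOrder α :=
    { le := r
      le_refl := hrefl
      le_trans := htrans
      le_antisymm := hanti
      le_total := htotal
      toDecidableLE := Classical.decRel _ }
  let e := Fintype.orderIsoFinOfCardEq α hm
  exact ⟨e.toEquiv, fun i j => e.le_iff_le.symm⟩

theorem IsCutRelation.exists_enum {R le : List Bool → List Bool → Prop} (h : IsCutRelation R le)
    {n : ℕ} {T : Finset (List Bool)} (hT : T ∈ cliques R n) :
    ∃ e : Fin T.card → List Bool, (∀ i j, i ≤ j ↔ le (e i) (e j)) ∧ Function.Injective e ∧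
      ∀ w, w ∈ T ↔ ∃ i, e i = w := by
  rw [mem_cliques] at hT
  obtain ⟨hlen, hR⟩ := hT
  have hl : ∀ {u v}, u ∈ T → v ∈ T → u.length = v.length := fun hu hv => by
    rw [hlen _ hu, hlen _ hv]
  obtain ⟨e, he⟩ := exists_equiv_fin_le_iff (α := T) (r := fun a b => le a b)
    (fun a => h.refl a) (fun a b c => h.trans)
    (fun a b hab hba => Subtype.ext (h.antisymm (hl a.2 b.2) hab hba))
    (fun a b => h.total (hl a.2 b.2) (hR _ a.2 _ b.2)) (Fintype.card_coe T)
  refine ⟨fun i => e i, he, fun i j hij => e.injective (Subtype.ext hij),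
    fun w => ⟨fun hw => ?_, ?_⟩⟩
  · exact ⟨e.symm ⟨w, hw⟩, by simp⟩
  · rintro ⟨i, rfl⟩
    exact (e i).2

open Classical in
theorem IsCutRelation.sum_fiber {R le : List Bool → List Bool → Prop} (h : IsCutRelation R le)
    {n : ℕ} {T : Finset (List Bool)} (hT : T ∈ cliques R n) (f : ℕ → ℕ) :
    ∑ U ∈ (cliques R (n + 1)).filter (fun U => U.image List.tail = T), f U.card =
      ∑ V ∈ cuts T.card, f V.card := by
  obtain ⟨e, hle, hinj, hmem⟩ := h.exists_enum hT
  rw [mem_cliques] at hT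
  obtain ⟨hlen, hR⟩ := hT
  have he : ∀ i, e i ∈ T := fun i => (hmem _).2 ⟨i, rfl⟩
  let φ : Bool × Fin T.card ↪ List Bool :=
    ⟨fun x => x.1 :: e x.2, fun x y hxy => by
      have := List.cons.inj hxy
      exact Prod.ext this.1 (hinj this.2)⟩
  symm
  refine Finset.sum_nbij (fun V => V.map φ) (fun V hV => ?_)
    (fun V _ W _ hVW => Finset.map_injective φ hVW) (fun U hU => ?_)
    (fun V _ => by rw [Finset.card_map])
  · simp only [cuts, Finset.mem_filter, Finset.mem_univ, true_and] at hV
    obtain ⟨himg, hcut⟩ := hV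
    rw [Finset.mem_filter, mem_cliques]
    refine ⟨⟨?_, ?_⟩, ?_⟩
    · intro u hu
      obtain ⟨x, hx, rfl⟩ := Finset.mem_map.1 hu
      exact congrArg Nat.succ (hlen _ (he x.2))
    · intro u hu v hv
      obtain ⟨⟨s, i⟩, hx, rfl⟩ := Finset.mem_map.1 hu
      obtain ⟨⟨t, j⟩, hy, rfl⟩ := Finset.mem_map.1 hv
      refine (h.cons_iff ((hlen _ (he i)).trans (hlen _ (he j)).symm) s t).2
        ⟨hR _ (he i) _ (he j), ?_, ?_⟩
      · rintro rfl rfl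
        exact (hle _ _).1 (hcut _ _ hx hy)
      · rintro rfl rfl
        exact (hle _ _).1 (hcut _ _ hy hx)
    · ext w
      rw [hmem]
      constructor
      · intro hw
        obtain ⟨u, hu, rfl⟩ := Finset.mem_image.1 hw
        obtain ⟨x, hx, rfl⟩ := Finset.mem_map.1 hu
        exact ⟨x.2, rfl⟩
      · rintro ⟨i, rfl⟩
        obtain ⟨x, hx, rfl⟩ := Finset.mem_image.1 (himg ▸ Finset.mem_univ i)
        exact Finset.mem_image.2 ⟨φ x, Finset.mem_map_of_mem _ hx, rfl⟩
  · obtain ⟨hU, himg⟩ := Finset.mem_filter.1 (Finset.mem_coe.1 hU)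
    rw [mem_cliques] at hU
    obtain ⟨hUlen, hUR⟩ := hU
    have hform : ∀ u ∈ U, ∃ x, φ x = u := by
      intro u hu
      have hl := hUlen u hu
      cases u with
      | nil => simp at hl
      | cons s w =>
        obtain ⟨i, rfl⟩ := (hmem w).1 (himg ▸ Finset.mem_image.2 ⟨_, hu, rfl⟩)
        exact ⟨(s, i), rfl⟩
    refine ⟨Finset.univ.filter fun x => φ x ∈ U, ?_, ?_⟩
    · simp only [cuts, Finset.coe_filter, Finset.mem_univ, true_and, Set.mem_ofPred_eq,
        Finset.mem_filter]
      refine ⟨?_, fun a b ha hb => ?_⟩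
      · ext i
        simp only [Finset.mem_image, Finset.mem_filter, Finset.mem_univ, true_and, iff_true]
        have hi : e i ∈ U.image List.tail := by rw [himg]; exact he i
        obtain ⟨u, hu, hui⟩ := Finset.mem_image.1 hi
        obtain ⟨x, rfl⟩ := hform u hu
        exact ⟨x, hu, hinj hui⟩
      · exact (hle _ _).2 (((h.cons_iff ((hlen _ (he a)).trans (hlen _ (he b)).symm) _ _).1
          (hUR _ ha _ hb)).2.1 rfl rfl)
    · ext u
      simp only [Finset.mem_map, Finset.mem_filter, Finset.mem_univ, true_and]
      constructor
      · rintro ⟨x, hx, rfl⟩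
        exact hx
      · intro hu
        obtain ⟨x, rfl⟩ := hform u hu
        exact ⟨x, hu, rfl⟩

theorem IsCutRelation.sum_cliques_succ {R le : List Bool → List Bool → Prop}
    (h : IsCutRelation R le) (n : ℕ) (f : ℕ → ℕ) :
    ∑ U ∈ cliques R (n + 1), f U.card =
      ∑ T ∈ cliques R n, ∑ V ∈ cuts T.card, f V.card := by
  classical
  rw [← Finset.sum_fiberwise_of_maps_to (t := cliques R n) (g := fun U => U.image List.tail)]
  · exact Finset.sum_congr rfl fun T hT => h.sum_fiber hT f
  · intro U hU
    rw [mem_cliques] at hU ⊢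
    obtain ⟨hlen, hR⟩ := hU
    refine ⟨?_, ?_⟩
    · intro w hw
      obtain ⟨u, hu, rfl⟩ := Finset.mem_image.1 hw
      simp [hlen u hu]
    · intro w hw w' hw'
      obtain ⟨u, hu, rfl⟩ := Finset.mem_image.1 hw
      obtain ⟨v, hv, rfl⟩ := Finset.mem_image.1 hw'
      have hu' := hlen u hu
      have hv' := hlen v hv
      have huv := hR u hu v hv
      cases u with
      | nil => simp at hu'
      | cons s u =>
        cases v with
        | nil => simp at hv'
        | cons t v => exact ((h.cons_iff (Nat.succ.inj (hu'.trans hv'.symm)) s t).1 huv).1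

theorem IsCutRelation.cliques_zero {R le : List Bool → List Bool → Prop}
    (h : IsCutRelation R le) : cliques R 0 = {∅, {[]}} := by
  ext T
  rw [mem_cliques, Finset.mem_insert, Finset.mem_singleton, ← Finset.subset_singleton_iff,
    Finset.subset_iff]
  simp only [List.length_eq_zero_iff, Finset.mem_singleton, and_iff_left_iff_imp]
  intro hT u hu v hv
  rw [hT u hu, hT v hv]
  exact h.nil

theorem IsCutRelation.sum_cliques_eq {R le R' le' : List Bool → List Bool → Prop}
    (h : IsCutRelation R le) (h' : IsCutRelation R' le') (n : ℕ) (f : ℕ → ℕ) :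
    ∑ T ∈ cliques R n, f T.card = ∑ T ∈ cliques R' n, f T.card := by
  induction n generalizing f with
  | zero => rw [h.cliques_zero, h'.cliques_zero]
  | succ n ih =>
    rw [h.sum_cliques_succ, h'.sum_cliques_succ]
    exact ih fun m => ∑ V ∈ cuts m, f V.card

/-- The number of cliques of each size does not depend on the cut relation. -/
theorem IsCutRelation.card_cliques_eq {R le R' le' : List Bool → List Bool → Prop}
    (h : IsCutRelation R le) (h' : IsCutRelation R' le') (n k : ℕ) :
    ((cliques R n).filter fun T => T.card = k).card =
      ((cliques R' n).filter fun T => T.card = k).card := by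
  simpa only [Finset.card_filter] using h.sum_cliques_eq h' n fun m => if m = k then 1 else 0

theorem Cross.symm {x y : SArc} (h : Cross x y) : Cross y x :=
  ⟨h.1.symm, h.2.symm⟩

theorem DiagCross.symm {p q : List SArc} : DiagCross p q → DiagCross q p :=
  fun ⟨x, hx, y, hy, h⟩ => ⟨y, hy, x, hx, h.symm⟩

theorem diagCross_cons {x y : SArc} {p q : List SArc} :
    DiagCross (x :: p) (y :: q) ↔
      Cross x y ∨ (∃ z ∈ q, Cross x z) ∨ (∃ z ∈ p, Cross z y) ∨ DiagCross p q := by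
  simp only [DiagCross, List.mem_cons, exists_eq_or_imp, or_assoc, exists_or, and_or_left]
  grind

/-- Two reversed arc diagrams have a common stretch at their head, after which the first one
continues with an arc starting further left. -/
def Before : List SArc → List SArc → Prop
  | x :: p, y :: q => (x.2 = y.2 ∧ x.1 < y.1) ∨ (x = y ∧ Before p q)
  | _, _ => False

theorem before_iff_exists {p q : List SArc} :
    Before p q ↔ ∃ (M : List SArc) (a a' i : ℕ) (σ : Bool), a < a' ∧
      M ++ [(a, i, σ)] <+: p ∧ M ++ [(a', i, σ)] <+: q := by
  induction p generalizing q with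
  | nil => simp [Before]
  | cons x p ih =>
    cases q with
    | nil => simp [Before]
    | cons y q =>
      rw [Before, ih]
      constructor
      · rintro (⟨h, hlt⟩ | ⟨rfl, M, a, a', i, σ, hlt, hp, hq⟩)
        · refine ⟨[], x.1, y.1, x.2.1, x.2.2, hlt, by simp, ?_⟩
          rw [h]
          simp
        · exact ⟨x :: M, a, a', i, σ, hlt, by simpa using hp, by simpa using hq⟩
      · rintro ⟨M, a, a', i, σ, hlt, hp, hq⟩
        cases M with
        | nil =>
          simp only [List.nil_append, List.cons_prefix_cons, List.nil_prefix, and_true] at hp hq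
          subst hp hq
          exact Or.inl ⟨rfl, hlt⟩
        | cons z M =>
          simp only [List.cons_append, List.cons_prefix_cons] at hp hq
          exact Or.inr ⟨hp.1.symm.trans hq.1, M, a, a', i, σ, hlt, hp.2, hq.2⟩

/-- Interference of reversed arc diagrams. -/
def RevInterfere (p q : List SArc) : Prop :=
  ∃ (j b b' : ℕ) (τ : Bool) (p' q' : List SArc), b < b' ∧
    (j, b, τ) :: p' <:+ p ∧ (j, b', τ) :: q' <:+ q ∧ Before p' q'

theorem interfere_reverse_iff {p q : List SArc} :
    Interfere p.reverse q.reverse ↔ RevInterfere p q := by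
  have key : ∀ (M r : List SArc) (x y : SArc),
      (x :: (M ++ [y]) <:+: r.reverse) ↔ ∃ r', y :: r' <:+ r ∧ M.reverse ++ [x] <+: r' := by
    intro M r x y
    rw [← List.reverse_infix, List.reverse_reverse, List.infix_iff_prefix_suffix]
    simp only [List.reverse_cons, List.reverse_append, List.reverse_nil, List.nil_append,
      List.cons_append]
    constructor
    · rintro ⟨t, ht, htr⟩
      cases t with
      | nil => simp at ht
      | cons z t =>
        rw [List.cons_prefix_cons] at ht
        obtain ⟨rfl, ht⟩ := ht
        exact ⟨t, htr, ht⟩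
    · rintro ⟨r', hr, hM⟩
      exact ⟨y :: r', List.cons_prefix_cons.2 ⟨rfl, hM⟩, hr⟩
  simp only [Interfere, RevInterfere, key, before_iff_exists]
  constructor
  · rintro ⟨M, a, a', b, b', i, j, σ, τ, ha, hb, ⟨p', hp, hMp⟩, q', hq, hMq⟩
    exact ⟨j, b, b', τ, p', q', hb, hp, hq, M.reverse, a, a', i, σ, ha, hMp, hMq⟩
  · rintro ⟨j, b, b', τ, p', q', hb, hp, hq, M, a, a', i, σ, ha, hMp, hMq⟩
    exact ⟨M.reverse, a, a', b, b', i, j, σ, τ, ha, hb, ⟨p', hp, by simpa using hMp⟩,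
      q', hq, by simpa using hMq⟩

/-- All arcs of the list run from left to right and end at or before `m`. -/
def EndsBy (m : ℕ) (p : List SArc) : Prop := ∀ x ∈ p, x.1 < x.2.1 ∧ x.2.1 ≤ m

theorem EndsBy.cons {i n : ℕ} {σ : Bool} {p : List SArc} (hi : i < n) (hp : EndsBy i p) :
    EndsBy n ((i, n, σ) :: p) := by
  intro x hx
  rcases List.mem_cons.1 hx with rfl | hx
  · exact ⟨hi, le_rfl⟩
  · exact ⟨(hp x hx).1, (hp x hx).2.trans hi.le⟩

theorem EndsBy.of_suffix {m i n : ℕ} {σ : Bool} {p p' : List SArc} (hp : EndsBy m p)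
    (h : (i, n, σ) :: p' <:+ p) : i < n ∧ n ≤ m :=
  hp _ (h.subset List.mem_cons_self)

theorem EndsBy.mono {m n : ℕ} {p : List SArc} (hp : EndsBy m p) (h : m ≤ n) : EndsBy n p :=
  fun x hx => ⟨(hp x hx).1, (hp x hx).2.trans h⟩

theorem revInterfere_cons_left {m : ℕ} {x : SArc} {p q : List SArc} (hq : EndsBy m q)
    (hx : m ≤ x.2.1) : RevInterfere (x :: p) q ↔ RevInterfere p q := by
  constructor
  · rintro ⟨k, b, b', ρ, p', q', hb, hp, hs, h⟩
    rcases List.suffix_cons_iff.1 hp with hp | hp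
    · obtain rfl := (List.cons.inj hp).1
      have := hq.of_suffix hs
      simp only at hx
      lia
    · exact ⟨k, b, b', ρ, p', q', hb, hp, hs, h⟩
  · rintro ⟨k, b, b', ρ, p', q', hb, hp, hs, h⟩
    exact ⟨k, b, b', ρ, p', q', hb, hp.trans (List.suffix_cons _ _), hs, h⟩

theorem revInterfere_cons_right {m : ℕ} {y : SArc} {p q : List SArc} (hp : EndsBy m p)
    (hy : m ≤ y.1) : RevInterfere p (y :: q) ↔ RevInterfere p q := by
  constructor
  · rintro ⟨k, b, b', ρ, p', q', hb, hs, hq, h⟩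
    rcases List.suffix_cons_iff.1 hq with hq | hq
    · obtain rfl := (List.cons.inj hq).1
      have := hp.of_suffix hs
      simp only at hy
      lia
    · exact ⟨k, b, b', ρ, p', q', hb, hs, hq, h⟩
  · rintro ⟨k, b, b', ρ, p', q', hb, hs, hq, h⟩
    exact ⟨k, b, b', ρ, p', q', hb, hs, hq.trans (List.suffix_cons _ _), h⟩

theorem revInterfere_extend_right {j n : ℕ} {τ : Bool} {p q : List SArc} (hp : EndsBy n p) :
    RevInterfere p ((j, n + 1, τ) :: q) ↔
      RevInterfere p ((j, n, τ) :: q) ∨ ∃ p', (j, n, τ) :: p' <:+ p ∧ Before p' q := by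
  constructor
  · rintro ⟨k, b, b', ρ, p', q', hb, hs, hq, h⟩
    rcases List.suffix_cons_iff.1 hq with hq | hq
    · simp only [List.cons.injEq, Prod.mk.injEq] at hq
      obtain ⟨⟨rfl, rfl, rfl⟩, rfl⟩ := hq
      rcases (Nat.lt_succ_iff.1 hb).eq_or_lt with rfl | hb
      · exact Or.inr ⟨p', hs, h⟩
      · exact Or.inl ⟨_, _, _, _, _, _, hb, hs, List.suffix_rfl, h⟩
    · exact Or.inl ⟨_, _, _, _, _, _, hb, hs, hq.trans (List.suffix_cons _ _), h⟩
  · rintro (⟨k, b, b', ρ, p', q', hb, hs, hq, h⟩ | ⟨p', hs, h⟩)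
    · rcases List.suffix_cons_iff.1 hq with hq | hq
      · simp only [List.cons.injEq, Prod.mk.injEq] at hq
        obtain ⟨⟨rfl, rfl, rfl⟩, rfl⟩ := hq
        exact ⟨_, _, _, _, _, _, hb.trans (Nat.lt_succ_self _), hs, List.suffix_rfl, h⟩
      · exact ⟨_, _, _, _, _, _, hb, hs, hq.trans (List.suffix_cons _ _), h⟩
    · exact ⟨_, _, _, _, _, _, Nat.lt_succ_self n, hs, List.suffix_rfl, h⟩

/-- Compatibility of reversed arc diagrams. -/
def Coherent (p q : List SArc) : Prop :=
  ¬ DiagCross p q ∧ ¬ RevInterfere p q ∧ ¬ RevInterfere q p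

theorem Coherent.symm {p q : List SArc} (h : Coherent p q) : Coherent q p :=
  ⟨fun hc => h.1 hc.symm, h.2.2, h.2.1⟩

theorem coherent_comm {p q : List SArc} : Coherent p q ↔ Coherent q p :=
  ⟨Coherent.symm, Coherent.symm⟩

section Step

variable {i j n : ℕ} {σ τ : Bool} {p q : List SArc}

theorem revInterfere_extend_extend (hi : i < n) (hj : j < n) (hp : EndsBy i p)
    (hq : EndsBy j q) :
    RevInterfere ((i, n + 1, σ) :: p) ((j, n + 1, τ) :: q) ↔
      RevInterfere ((i, n, σ) :: p) ((j, n, τ) :: q) := by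
  rw [revInterfere_cons_left (hq.cons (hj.trans n.lt_succ_self)) le_rfl,
    revInterfere_cons_left (hq.cons hj) le_rfl, revInterfere_extend_right (hp.mono hi.le),
    or_iff_left]
  rintro ⟨p', hs, -⟩
  have := hp.of_suffix hs
  lia

theorem diagCross_extend_extend (hi : i < n) (hj : j < n) (hp : EndsBy i p)
    (hq : EndsBy j q) :
    DiagCross ((i, n + 1, σ) :: p) ((j, n + 1, τ) :: q) ↔
      DiagCross ((i, n, σ) :: p) ((j, n, τ) :: q) := by
  simp only [diagCross_cons]
  have h1 : ∀ z ∈ q, Cross (i, n + 1, σ) z ↔ Cross (i, n, σ) z := fun z hz => by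
    have := hq z hz
    simp only [Cross]
    grind
  have h2 : ∀ z ∈ p, Cross z (j, n + 1, τ) ↔ Cross z (j, n, τ) := fun z hz => by
    have := hp z hz
    simp only [Cross]
    grind
  have h3 : Cross (i, n + 1, σ) (j, n + 1, τ) ↔ Cross (i, n, σ) (j, n, τ) := by
    simp only [Cross]
    grind
  grind

theorem coherent_extend_extend (hi : i < n) (hj : j < n) (hp : EndsBy i p)
    (hq : EndsBy j q) :
    Coherent ((i, n + 1, σ) :: p) ((j, n + 1, τ) :: q) ↔
      Coherent ((i, n, σ) :: p) ((j, n, τ) :: q) := by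
  rw [Coherent, diagCross_extend_extend hi hj hp hq, revInterfere_extend_extend hi hj hp hq,
    revInterfere_extend_extend hj hi hq hp, Coherent]

theorem revInterfere_turn_extend (hi : i < n) (hj : j < n) (hp : EndsBy i p)
    (hq : EndsBy j q) (s : Bool) :
    RevInterfere ((n, n + 1, s) :: (i, n, σ) :: p) ((j, n + 1, τ) :: q) ↔
      RevInterfere ((i, n, σ) :: p) ((j, n, τ) :: q) ∨ (i = j ∧ σ = τ ∧ Before p q) := by
  rw [revInterfere_cons_left (hq.cons (hj.trans n.lt_succ_self)) le_rfl,
    revInterfere_extend_right (hp.cons hi)]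
  refine or_congr Iff.rfl ⟨?_, ?_⟩
  · rintro ⟨p', hs, h⟩
    rcases List.suffix_cons_iff.1 hs with hs | hs
    · simp only [List.cons.injEq, Prod.mk.injEq] at hs
      obtain ⟨⟨rfl, -, rfl⟩, rfl⟩ := hs
      exact ⟨rfl, rfl, h⟩
    · have := hp.of_suffix hs
      lia
  · rintro ⟨rfl, rfl, h⟩
    exact ⟨p, List.suffix_rfl, h⟩

theorem revInterfere_extend_turn (hi : i < n) (hj : j < n) (hp : EndsBy i p)
    (hq : EndsBy j q) (s : Bool) :
    RevInterfere ((j, n + 1, τ) :: q) ((n, n + 1, s) :: (i, n, σ) :: p) ↔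
      RevInterfere ((j, n, τ) :: q) ((i, n, σ) :: p) := by
  rw [revInterfere_cons_left ((hp.cons hi).cons n.lt_succ_self) le_rfl,
    revInterfere_cons_right (hq.mono hj.le) le_rfl, revInterfere_cons_left (hp.cons hi) le_rfl]

theorem revInterfere_turn_turn (hi : i < n) (hj : j < n) (hp : EndsBy i p)
    (hq : EndsBy j q) (s t : Bool) :
    RevInterfere ((n, n + 1, s) :: (i, n, σ) :: p) ((n, n + 1, t) :: (j, n, τ) :: q) ↔
      RevInterfere ((i, n, σ) :: p) ((j, n, τ) :: q) := by
  rw [revInterfere_cons_left ((hq.cons hj).cons n.lt_succ_self) le_rfl,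
    revInterfere_cons_right (hp.cons hi) le_rfl]

theorem diagCross_turn_extend (hi : i < n) (hj : j < n) (hp : EndsBy i p)
    (hq : EndsBy j q) (s : Bool) :
    DiagCross ((n, n + 1, s) :: (i, n, σ) :: p) ((j, n + 1, τ) :: q) ↔
      DiagCross ((i, n, σ) :: p) ((j, n, τ) :: q) ∨ (i < j ∧ σ = τ) := by
  simp only [DiagCross, List.mem_cons, exists_eq_or_imp]
  have h1 : ∀ z ∈ q, ¬ Cross (n, n + 1, s) z := fun z hz => by
    have := hq z hz
    simp only [Cross]
    grind
  have h2 : ∀ z ∈ p, Cross z (j, n + 1, τ) ↔ Cross z (j, n, τ) := fun z hz => by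
    have := hp z hz
    simp only [Cross]
    grind
  have h3 : ¬ Cross (n, n + 1, s) (j, n + 1, τ) := by
    simp only [Cross]
    grind
  have h4 : Cross (i, n, σ) (j, n + 1, τ) ↔ i < j ∧ σ = τ := by
    simp only [Cross]
    grind
  have h5 : ¬ Cross (i, n, σ) (j, n, τ) := by
    simp only [Cross]
    grind
  grind

theorem diagCross_turn_turn (hi : i < n) (hj : j < n) (hp : EndsBy i p)
    (hq : EndsBy j q) {s t : Bool} (hs : s ≠ σ) (ht : t ≠ τ) :
    DiagCross ((n, n + 1, s) :: (i, n, σ) :: p) ((n, n + 1, t) :: (j, n, τ) :: q) ↔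
      DiagCross ((i, n, σ) :: p) ((j, n, τ) :: q) ∨ s ≠ t := by
  rw [diagCross_cons]
  have h1 : (∃ z ∈ (j, n, τ) :: q, Cross (n, n + 1, s) z) ↔ s = τ := by
    constructor
    · rintro ⟨z, hz, h⟩
      rcases List.mem_cons.1 hz with rfl | hz
      · exact h.1
      · have := hq z hz
        simp only [Cross] at h
        lia
    · rintro rfl
      exact ⟨_, List.mem_cons_self, by simp [Cross, hj]⟩
  have h2 : (∃ z ∈ (i, n, σ) :: p, Cross z (n, n + 1, t)) ↔ t = σ := by
    constructor
    · rintro ⟨z, hz, h⟩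
      rcases List.mem_cons.1 hz with rfl | hz
      · exact h.1.symm
      · have := hp z hz
        simp only [Cross] at h
        lia
    · rintro rfl
      exact ⟨_, List.mem_cons_self, by simp [Cross, hi]⟩
  have h3 : ¬ Cross (n, n + 1, s) (n, n + 1, t) := by simp [Cross]
  rw [h1, h2]
  revert hs ht
  cases s <;> cases t <;> cases σ <;> cases τ <;> simp [h3]

theorem coherent_turn_extend (hi : i < n) (hj : j < n) (hp : EndsBy i p)
    (hq : EndsBy j q) (s : Bool) :
    Coherent ((n, n + 1, s) :: (i, n, σ) :: p) ((j, n + 1, τ) :: q) ↔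
      Coherent ((i, n, σ) :: p) ((j, n, τ) :: q) ∧
        ¬ Before ((i, n, σ) :: p) ((j, n, τ) :: q) := by
  rw [Coherent, diagCross_turn_extend hi hj hp hq, revInterfere_turn_extend hi hj hp hq,
    revInterfere_extend_turn hi hj hp hq, Coherent, Before]
  simp only [Prod.mk.injEq]
  grind

theorem coherent_turn_turn (hi : i < n) (hj : j < n) (hp : EndsBy i p)
    (hq : EndsBy j q) {s t : Bool} (hs : s ≠ σ) (ht : t ≠ τ) :
    Coherent ((n, n + 1, s) :: (i, n, σ) :: p) ((n, n + 1, t) :: (j, n, τ) :: q) ↔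
      Coherent ((i, n, σ) :: p) ((j, n, τ) :: q) ∧ s = t := by
  rw [Coherent, diagCross_turn_turn hi hj hp hq hs ht, revInterfere_turn_turn hi hj hp hq,
    revInterfere_turn_turn hj hi hq hp, Coherent]
  tauto

end Step

/-- Lengthen the first arc of a list by one gap. -/
def extendHead : List SArc → List SArc
  | [] => []
  | (i, n, σ) :: p => (i, n + 1, σ) :: p

/-- The reversed arc diagram whose gaps, read from right to left, have the given signs. -/
def arcsRev : List Bool → List SArc
  | [] => []
  | [s] => [(0, 1, s)]
  | s :: t :: w =>
    if s = t then extendHead (arcsRev (t :: w))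
    else (w.length + 1, w.length + 2, s) :: arcsRev (t :: w)

theorem arcsRev_cons (s : Bool) (w : List Bool) :
    ∃ i p, arcsRev (s :: w) = (i, w.length + 1, s) :: p ∧ i < w.length + 1 ∧ EndsBy i p := by
  induction w generalizing s with
  | nil => exact ⟨0, [], rfl, Nat.one_pos, by simp [EndsBy]⟩
  | cons t w ih =>
    obtain ⟨i, p, h, hi, hp⟩ := ih t
    rw [arcsRev, h]
    split_ifs with hst
    · subst hst
      exact ⟨i, p, rfl, hi.trans (Nat.lt_succ_self _), hp⟩
    · exact ⟨_, _, rfl, Nat.lt_succ_self _, hp.cons hi⟩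

/-- The comparison of words that corresponds to `Before` on reversed arc diagrams. -/
def WordBefore : List Bool → List Bool → Prop
  | s :: u, t :: v => s = t ∧ ((u.head? ≠ v.head? ∧ u.head? = some s) ∨ WordBefore u v)
  | _, _ => False

theorem before_arcsRev_iff {u v : List Bool} (h : u.length = v.length) :
    Before (arcsRev u) (arcsRev v) ↔ WordBefore u v := by
  induction u generalizing v with
  | nil => simp [arcsRev, Before, WordBefore]
  | cons s u ih =>
    rcases v with _ | ⟨t, v⟩
    · simp at h
    have h := Nat.succ.inj h
    specialize ih h
    rcases u with _ | ⟨σ, u⟩ <;> rcases v with _ | ⟨τ, v⟩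
    · simp [arcsRev, Before, WordBefore]
    · simp at h
    · simp at h
    have h := Nat.succ.inj h
    obtain ⟨i, p, hu, hi, -⟩ := arcsRev_cons σ u
    obtain ⟨j, q, hv, hj, -⟩ := arcsRev_cons τ v
    rw [h] at hi
    rw [WordBefore, ← ih, arcsRev, arcsRev, hu, hv, h]
    by_cases hs : s = σ <;> by_cases ht : t = τ
    · subst hs ht
      simp only [if_true, extendHead, Before, Prod.mk.injEq, List.head?_cons]
      grind
    · subst hs
      simp only [if_true, if_neg ht, extendHead, Before, Prod.mk.injEq, List.head?_cons]
      grind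
    · subst ht
      simp only [if_true, if_neg hs, extendHead, Before, Prod.mk.injEq, List.head?_cons]
      grind
    · simp only [if_neg hs, if_neg ht, Before, Prod.mk.injEq, List.head?_cons]
      grind

theorem WordBefore.head?_eq {u v : List Bool} (h : WordBefore u v) : u.head? = v.head? := by
  cases u <;> cases v <;> simp_all [WordBefore]

theorem not_wordBefore_self (u : List Bool) : ¬ WordBefore u u := by
  induction u <;> simp_all [WordBefore]

theorem WordBefore.trans {u v w : List Bool} (h : WordBefore u v) (h' : WordBefore v w) :
    WordBefore u w := by
  induction u generalizing v w with
  | nil => simp [WordBefore] at h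
  | cons s u ih =>
    rcases v with _ | ⟨t, v⟩
    · simp [WordBefore] at h
    rcases w with _ | ⟨r, w⟩
    · simp [WordBefore] at h'
    obtain ⟨rfl, h⟩ := h
    obtain ⟨rfl, h'⟩ := h'
    refine ⟨rfl, ?_⟩
    rcases h with h | h <;> rcases h' with h' | h'
    · exact absurd (h.2.trans h'.2.symm) h.1
    · exact Or.inl (h'.head?_eq ▸ h)
    · exact Or.inl (h.head?_eq ▸ h')
    · exact Or.inr (ih h h')

theorem wordBefore_trichotomy {u v : List Bool} (h : u.length = v.length)
    (hd : u.head? = v.head?) : WordBefore u v ∨ u = v ∨ WordBefore v u := by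
  induction u generalizing v with
  | nil => simp [List.eq_nil_of_length_eq_zero h.symm]
  | cons s u ih =>
    rcases v with _ | ⟨t, v⟩
    · simp at h
    obtain rfl : s = t := by simpa using hd
    have h := Nat.succ.inj h
    by_cases hd' : u.head? = v.head?
    · rcases ih h hd' with h | rfl | h
      · exact Or.inl ⟨rfl, Or.inr h⟩
      · exact Or.inr (Or.inl rfl)
      · exact Or.inr (Or.inr ⟨rfl, Or.inr h⟩)
    · by_cases hs : u.head? = some s
      · exact Or.inl ⟨rfl, Or.inl ⟨hd', hs⟩⟩
      · refine Or.inr (Or.inr ⟨rfl, Or.inl ⟨Ne.symm hd', ?_⟩⟩)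
        rcases u with _ | ⟨σ, u⟩ <;> rcases v with _ | ⟨τ, v⟩ <;> simp at *
        revert hs hd'
        cases σ <;> cases τ <;> cases s <;> simp

/-- The linear order on words of a given length by which arc diagrams are cut: those ending with a
`−` arc come first, ordered by `WordBefore`, then those ending with a `+` arc, in opposite order. -/
def CutLE (u v : List Bool) : Prop :=
  u = v ∨ (u.head? = some false ∧ v.head? = some true) ∨
    (u.head? = some false ∧ WordBefore u v) ∨ (u.head? = some true ∧ WordBefore v u)

theorem CutLE.trans {u v w : List Bool} (h : CutLE u v) (h' : CutLE v w) : CutLE u w := by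
  have h1 := @WordBefore.head?_eq
  have h2 := @WordBefore.trans
  unfold CutLE at *
  grind

theorem CutLE.antisymm {u v : List Bool} (h : CutLE u v) (h' : CutLE v u) : u = v := by
  have h1 := @WordBefore.head?_eq
  have h2 := @WordBefore.trans
  have h3 := not_wordBefore_self
  unfold CutLE at *
  grind

theorem cutLE_total {u v : List Bool} (h : u.length = v.length) : CutLE u v ∨ CutLE v u := by
  have h1 := wordBefore_trichotomy h
  rcases u with _ | ⟨s, u⟩ <;> rcases v with _ | ⟨t, v⟩
  · exact Or.inl (Or.inl rfl)
  · simp at h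
  · simp at h
  · cases s <;> cases t <;> simp_all [CutLE] <;> grind

theorem not_wordBefore_iff {u v : List Bool} (h : u.length = v.length)
    (hd : u.head? = v.head?) : ¬ WordBefore u v ↔ u = v ∨ WordBefore v u := by
  have h1 := wordBefore_trichotomy h hd
  have h2 := @WordBefore.trans
  have h3 := not_wordBefore_self
  grind

theorem coherent_arcsRev_cons {u v : List Bool} (h : u.length = v.length) (s t : Bool) :
    Coherent (arcsRev (s :: u)) (arcsRev (t :: v)) ↔
      Coherent (arcsRev u) (arcsRev v) ∧ (s = false → t = true → CutLE u v) ∧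
        (s = true → t = false → CutLE v u) := by
  rcases u with _ | ⟨σ, u⟩ <;> rcases v with _ | ⟨τ, v⟩
  · simp [arcsRev, Coherent, DiagCross, RevInterfere, Cross, CutLE, Before,
      List.suffix_cons_iff]
  · simp at h
  · simp at h
  have hbuv := before_arcsRev_iff h
  have hbvu := before_arcsRev_iff h.symm
  have hnuv := not_wordBefore_iff h
  have hnvu := not_wordBefore_iff h.symm
  have hhd := @WordBefore.head?_eq (σ :: u) (τ :: v)
  have hhd' := @WordBefore.head?_eq (τ :: v) (σ :: u)
  have hn := Nat.succ.inj h
  obtain ⟨i, p, hu, hi, hp⟩ := arcsRev_cons σ u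
  obtain ⟨j, q, hv, hj, hq⟩ := arcsRev_cons τ v
  rw [hn] at hi
  rw [hu, hv, hn] at hbuv hbvu
  rw [arcsRev, arcsRev, hu, hv, hn]
  by_cases hs : s = σ <;> by_cases ht : t = τ
  · subst hs ht
    simp only [if_true, extendHead, coherent_extend_extend hi hj hp hq, CutLE, List.head?_cons]
    grind
  · subst hs
    simp only [if_true, if_neg ht, extendHead]
    rw [coherent_comm, coherent_turn_extend hj hi hq hp, coherent_comm, hbvu]
    simp only [CutLE, List.head?_cons] at *
    cases s <;> cases t <;> cases τ <;> grind
  · subst ht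
    simp only [if_true, if_neg hs, extendHead]
    rw [coherent_turn_extend hi hj hp hq, hbuv]
    simp only [CutLE, List.head?_cons] at *
    cases s <;> cases t <;> cases σ <;> grind
  · simp only [if_neg hs, if_neg ht, coherent_turn_turn hi hj hp hq hs ht]
    simp only [CutLE, List.head?_cons] at *
    cases s <;> cases t <;> cases σ <;> cases τ <;> grind

theorem isCutRelation_coherent :
    IsCutRelation (fun u v => Coherent (arcsRev u) (arcsRev v)) CutLE where
  nil := by simp [arcsRev, Coherent, DiagCross, RevInterfere]
  cons_iff := coherent_arcsRev_cons
  refl _ := Or.inl rfl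
  antisymm _ := CutLE.antisymm
  trans := CutLE.trans
  total h _ := cutLE_total h

theorem isCutRelation_comparable :
    IsCutRelation (fun u v => List.Forall₂ (· ≤ ·) u v ∨ List.Forall₂ (· ≤ ·) v u)
      (List.Forall₂ (· ≤ ·)) where
  nil := by simp
  cons_iff h s t := by
    rw [List.forall₂_cons, List.forall₂_cons]
    cases s <;> cases t <;> simp <;> tauto
  refl u := List.forall₂_refl u
  antisymm _ h h' := by
    induction h with
    | nil => rfl
    | cons hab _ ih =>
      rw [List.forall₂_cons] at h'
      rw [le_antisymm hab h'.1, ih (by simp_all) h'.2]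
  trans h h' := by
    rename_i u v w
    induction h generalizing w with
    | nil => exact h'
    | cons hab _ ih =>
      rcases w with _ | ⟨c, w⟩
      · simp at h'
      rw [List.forall₂_cons] at h' ⊢
      exact ⟨hab.trans h'.1, ih h'.2⟩
  total _ h := h

/-- The gap `g` is covered by a `+` arc of the list. -/
def TopCovers (p : List SArc) (g : ℕ) : Prop :=
  ∃ x ∈ p, x.2.2 = true ∧ x.1 < g ∧ g ≤ x.2.1

theorem topCovers_cons {x : SArc} {p : List SArc} {g : ℕ} :
    TopCovers (x :: p) g ↔ (x.2.2 = true ∧ x.1 < g ∧ g ≤ x.2.1) ∨ TopCovers p g := by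
  simp [TopCovers]

theorem topCovers_arcsRev_cons (s : Bool) (u : List Bool) (g : ℕ) :
    TopCovers (arcsRev (s :: u)) g ↔
      TopCovers (arcsRev u) g ∨ (s = true ∧ g = u.length + 1) := by
  rcases u with _ | ⟨σ, u⟩
  · simp only [arcsRev, TopCovers, List.mem_singleton, List.length_nil]
    grind
  obtain ⟨i, p, hu, hi, -⟩ := arcsRev_cons σ u
  rw [arcsRev, hu]
  by_cases hs : s = σ
  · subst hs
    simp only [if_true, extendHead, topCovers_cons, List.length_cons]
    grind
  · simp only [if_neg hs, topCovers_cons, List.length_cons]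
    grind

theorem TopCovers.le_length {u : List Bool} {g : ℕ} (h : TopCovers (arcsRev u) g) :
    1 ≤ g ∧ g ≤ u.length := by
  induction u with
  | nil => simp [TopCovers, arcsRev] at h
  | cons s u ih =>
    rw [List.length_cons]
    rcases (topCovers_arcsRev_cons s u g).1 h with h | h
    · have := ih h
      lia
    · lia

theorem forall_topCovers_iff {u v : List Bool} (h : u.length = v.length) :
    (∀ g, TopCovers (arcsRev u) g → TopCovers (arcsRev v) g) ↔ List.Forall₂ (· ≤ ·) u v := by
  induction u generalizing v with
  | nil => simp [List.eq_nil_of_length_eq_zero h.symm]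
  | cons s u ih =>
    rcases v with _ | ⟨t, v⟩
    · simp at h
    have h := Nat.succ.inj h
    rw [List.forall₂_cons, ← ih h]
    simp only [topCovers_arcsRev_cons, h, Bool.le_iff_imp]
    have hu : ¬ TopCovers (arcsRev u) (v.length + 1) := fun hc => by
      have := hc.le_length
      lia
    have hv : ¬ TopCovers (arcsRev v) (v.length + 1) := fun hc => by
      have := hc.le_length
      lia
    cases s <;> cases t <;> simp <;> grind

theorem arcsRev_injective : Function.Injective arcsRev := by
  intro u v h
  have hl : u.length = v.length := by
    rcases u with _ | ⟨s, u⟩ <;> rcases v with _ | ⟨t, v⟩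
    · rfl
    · obtain ⟨i, p, hv, -⟩ := arcsRev_cons t v
      simp [hv, arcsRev] at h
    · obtain ⟨i, p, hu, -⟩ := arcsRev_cons s u
      simp [hu, arcsRev] at h
    · obtain ⟨i, p, hu, -⟩ := arcsRev_cons s u
      obtain ⟨j, q, hv, -⟩ := arcsRev_cons t v
      simp only [hu, hv, List.cons.injEq, Prod.mk.injEq] at h
      exact h.1.2.1
  exact isCutRelation_comparable.antisymm hl
    ((forall_topCovers_iff hl).1 (by simp [h])) ((forall_topCovers_iff hl.symm).1 (by simp [h]))

theorem apart_subset_iff {c : ℕ} {u v : List Bool} (hu : u.length = c + 1)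
    (hv : v.length = c + 1) :
    Apart c (arcsRev u).reverse ⊆ Apart c (arcsRev v).reverse ↔ List.Forall₂ (· ≤ ·) u v := by
  rw [← forall_topCovers_iff (hu.trans hv.symm), Finset.subset_iff]
  simp only [Apart, Finset.mem_filter, Finset.mem_Icc, List.mem_reverse]
  refine ⟨fun h g hg => (h ⟨?_, hg⟩).2, fun h g hg => ⟨hg.1, h g hg.2⟩⟩
  exact hu ▸ hg.le_length

/-- Reversed arc diagrams on `{0,…,n}`. -/
def IsRevDiagram : ℕ → List SArc → Prop
  | _, [] => False
  | n, [x] => x.1 = 0 ∧ x.2.1 = n ∧ x.1 < n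
  | n, x :: y :: p => x.2.1 = n ∧ x.1 < n ∧ x.2.2 ≠ y.2.2 ∧ IsRevDiagram x.1 (y :: p)

theorem isRevDiagram_iff {n : ℕ} {p : List SArc} :
    IsRevDiagram n p ↔ p ≠ [] ∧ (∀ x ∈ p.getLast?, x.1 = 0) ∧ (∀ x ∈ p.head?, x.2.1 = n) ∧
      p.IsChain (fun x y => y.2.1 = x.1 ∧ y.2.2 ≠ x.2.2) ∧ ∀ x ∈ p, x.1 < x.2.1 := by
  induction p generalizing n with
  | nil => simp [IsRevDiagram]
  | cons x p ih =>
    rcases p with _ | ⟨y, p⟩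
    · simp only [IsRevDiagram]
      simp
      grind
    · rw [IsRevDiagram, ih]
      simp
      grind

theorem isArcDiagram_reverse_iff {c : ℕ} {p : List SArc} :
    IsArcDiagram c p.reverse ↔ IsRevDiagram (c + 1) p := by
  rw [isRevDiagram_iff]
  change _ ∧ _ ∧ _ ∧ List.IsChain _ _ ∧ _ ↔ _
  simp only [List.isChain_reverse,
    List.head?_reverse, List.getLast?_reverse, List.mem_reverse, ne_eq, List.reverse_eq_nil_iff]

theorem isRevDiagram_extend_iff {i n : ℕ} {σ : Bool} {p : List SArc} (hi : i < n) :
    IsRevDiagram (n + 1) ((i, n + 1, σ) :: p) ↔ IsRevDiagram n ((i, n, σ) :: p) := by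
  cases p <;> simp [IsRevDiagram, hi, hi.trans n.lt_succ_self]

theorem isRevDiagram_arcsRev (s : Bool) (w : List Bool) :
    IsRevDiagram (w.length + 1) (arcsRev (s :: w)) := by
  induction w generalizing s with
  | nil => simp [arcsRev, IsRevDiagram]
  | cons t w ih =>
    obtain ⟨i, p, h, hi, -⟩ := arcsRev_cons t w
    specialize ih t
    rw [h] at ih
    rw [arcsRev, h]
    split_ifs with hst
    · subst hst
      exact (isRevDiagram_extend_iff hi).2 ih
    · exact ⟨rfl, Nat.lt_succ_self _, hst, ih⟩

theorem IsRevDiagram.exists_arcsRev {n : ℕ} {p : List SArc} (h : IsRevDiagram n p) :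
    ∃ w : List Bool, w.length = n ∧ arcsRev w = p := by
  induction n generalizing p with
  | zero => rcases p with _ | ⟨x, _ | ⟨y, p⟩⟩ <;> simp [IsRevDiagram] at h
  | succ n ih =>
    rcases p with _ | ⟨⟨i, m, σ⟩, p⟩
    · exact h.elim
    obtain ⟨rfl, hi⟩ : m = n + 1 ∧ i ≤ n := by
      cases p <;> simp only [IsRevDiagram] at h <;> lia
    rcases hi.eq_or_lt with rfl | hi
    · rcases p with _ | ⟨y, p⟩
      · obtain ⟨h0, -⟩ := h
        obtain rfl : i = 0 := h0
        exact ⟨[σ], rfl, rfl⟩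
      · obtain ⟨-, -, hσ, h⟩ := h
        obtain ⟨w, rfl, hw⟩ := ih h
        rcases w with _ | ⟨t, w⟩
        · simp [arcsRev] at hw
        obtain ⟨j, q, hq, -⟩ := arcsRev_cons t w
        have ht : y.2.2 = t := by
          rw [hq] at hw
          rw [← (List.cons.inj hw).1]
        refine ⟨σ :: t :: w, rfl, ?_⟩
        rw [arcsRev, if_neg (ht ▸ hσ), hw]
        rfl
    · obtain ⟨w, rfl, hw⟩ := ih ((isRevDiagram_extend_iff hi).1 h)
      rcases w with _ | ⟨t, w⟩
      · simp [arcsRev] at hw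
      obtain ⟨j, q, hq, -⟩ := arcsRev_cons t w
      have ht : σ = t := by
        rw [hq] at hw
        simp only [List.cons.injEq, Prod.mk.injEq] at hw
        exact hw.1.2.2.symm
      refine ⟨σ :: t :: w, rfl, ?_⟩
      rw [arcsRev, if_pos ht, hw]
      rfl

/-- The arc diagram whose gaps, read from right to left, have the given signs. -/
def diagram : List Bool ↪ List SArc :=
  ⟨fun w => (arcsRev w).reverse, fun _ _ h => arcsRev_injective (List.reverse_injective h)⟩

theorem diagram_apply (w : List Bool) : diagram w = (arcsRev w).reverse := rfl

theorem isArcDiagram_iff_exists {c : ℕ} {d : List SArc} :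
    IsArcDiagram c d ↔ ∃ w : List Bool, w.length = c + 1 ∧ diagram w = d := by
  rw [← d.reverse_reverse, isArcDiagram_reverse_iff]
  constructor
  · intro h
    obtain ⟨w, hw, hd⟩ := h.exists_arcsRev
    exact ⟨w, hw, congrArg List.reverse hd⟩
  · rintro ⟨w, hw, hd⟩
    rw [← List.reverse_injective hd]
    rcases w with _ | ⟨s, w⟩
    · simp at hw
    · exact hw ▸ isRevDiagram_arcsRev s w

theorem ncard_eq_card_cliques (c k : ℕ) {P : List SArc → List SArc → Prop}
    {R : List Bool → List Bool → Prop}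
    (h : ∀ u v : List Bool, u.length = c + 1 → v.length = c + 1 →
      (P (diagram u) (diagram v) ∧ P (diagram v) (diagram u) ↔ R u v)) :
    {T : Finset (List SArc) | T.card = k ∧ (∀ d ∈ T, IsArcDiagram c d) ∧
        ∀ d₁ ∈ T, ∀ d₂ ∈ T, P d₁ d₂}.ncard =
      ((cliques R (c + 1)).filter fun T => T.card = k).card := by
  rw [← Set.ncard_coe_finset, ← Set.ncard_image_of_injective _ (Finset.map_injective diagram)]
  congr 1
  ext T
  simp only [Set.mem_ofPred_eq, Set.mem_image, Finset.coe_filter, mem_cliques]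
  constructor
  · rintro ⟨hk, hT, hP⟩
    have hmap : (T.preimage diagram diagram.injective.injOn).map diagram = T := by
      ext d
      simp only [Finset.mem_map, Finset.mem_preimage]
      constructor
      · rintro ⟨w, hw, rfl⟩
        exact hw
      · intro hd
        obtain ⟨w, -, rfl⟩ := isArcDiagram_iff_exists.1 (hT d hd)
        exact ⟨w, hd, rfl⟩
    have hlen : ∀ u, diagram u ∈ T → u.length = c + 1 := by
      intro u hu
      obtain ⟨w, hw, hd⟩ := isArcDiagram_iff_exists.1 (hT _ hu)
      rwa [← diagram.injective hd]
    refine ⟨_, ⟨⟨?_, ?_⟩, ?_⟩, hmap⟩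
    · simpa using hlen
    · simp only [Finset.mem_preimage]
      exact fun u hu v hv => (h u v (hlen u hu) (hlen v hv)).1 ⟨hP _ hu _ hv, hP _ hv _ hu⟩
    · rw [← Finset.card_map diagram, hmap, hk]
  · rintro ⟨U, ⟨⟨hlen, hR⟩, hk⟩, rfl⟩
    simp only [Finset.card_map, Finset.forall_mem_map]
    exact ⟨hk, fun u hu => isArcDiagram_iff_exists.2 ⟨u, hlen u hu, rfl⟩,
      fun u hu v hv => ((h u v (hlen u hu) (hlen v hv)).2 (hR u hu v hv)).1⟩

/-- for every `c ≥ 1` and `k ≥ 1`, the number of `k`-element sets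
of pairwise stacked arc diagrams equals the number of `k`-element sets of
pairwise non-crossing and non-interfering arc diagrams (the mutoperhedron and
the permutohedron have the same `f`-vector). -/
theorem statement16 (c k : ℕ) (hc : 1 ≤ c) (hk : 1 ≤ k) :
    {T : Finset (List SArc) | T.card = k ∧ (∀ d ∈ T, IsArcDiagram c d) ∧
        ∀ d₁ ∈ T, ∀ d₂ ∈ T, Apart c d₁ ⊆ Apart c d₂ ∨ Apart c d₂ ⊆ Apart c d₁}.ncard
      = {T : Finset (List SArc) | T.card = k ∧ (∀ d ∈ T, IsArcDiagram c d) ∧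
          ∀ d₁ ∈ T, ∀ d₂ ∈ T, ¬ DiagCross d₁ d₂ ∧ ¬ Interfere d₁ d₂}.ncard := by
  rw [ncard_eq_card_cliques c k
      (R := fun u v => List.Forall₂ (· ≤ ·) u v ∨ List.Forall₂ (· ≤ ·) v u) ?_,
    ncard_eq_card_cliques c k (P := fun d₁ d₂ => ¬ DiagCross d₁ d₂ ∧ ¬ Interfere d₁ d₂)
      (R := fun u v => Coherent (arcsRev u) (arcsRev v)) ?_]
  · exact isCutRelation_comparable.card_cliques_eq isCutRelation_coherent (c + 1) k
  · intro u v _ _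
    have hcross : ∀ p q : List SArc, DiagCross p.reverse q.reverse ↔ DiagCross p q := by
      simp [DiagCross]
    simp only [diagram_apply, hcross, interfere_reverse_iff, Coherent]
    exact ⟨fun h => ⟨h.1.1, h.1.2, h.2.2⟩,
      fun h => ⟨⟨h.1, h.2.1⟩, fun hc => h.1 hc.symm, h.2.2⟩⟩
  · intro u v hu hv
    simp only [diagram_apply, apart_subset_iff hu hv,
      apart_subset_iff hv hu]
    tauto

end PaperDKK
end
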